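/- arXiv:2002.09920 — 7 statements merged into one kernel-verified Lean document; each statement's English description precedes it below -/
import Mathlib

section
/- For every positive integer k and every ε > 0, there exists a function u : ℝ² → ℝ of class C² such that: (i) Δu(x,y) + e^{u(x,y)} = 0 for all (x,y) ∈ ℝ²; (ii) u(−x,y) = u(x,y) for all (x,y); (iii) u is periodic in the second variable with some period T satisfying πk ≤ T < πk + ε; (iv) u is not independent of the second variable y (i.e. there exist (x,y₁), (x,y₂) with u(x,y₁) ≠ u(x,y₂)); (v) u(x,y) → −∞ as |x| → ∞, uniformly in y; and (vi) the volume ∫_{ℝ²} e^{u(x,y)} dx dy is infinite. -/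
open MeasureTheory

/-- The Laplacian on `ℝ × ℝ`: `Δu = ∂²u/∂x² + ∂²u/∂y²`. -/
noncomputable def lap2 (u : ℝ × ℝ → ℝ) (p : ℝ × ℝ) : ℝ :=
  iteratedDeriv 2 (fun x => u (x, p.2)) p.1 + iteratedDeriv 2 (fun y => u (p.1, y)) p.2

/-- The second derivative of `K - 2 log g` for a positive function `g`. -/
theorem iteratedDeriv_two_const_sub_two_mul_log {g g' g'' : ℝ → ℝ} (K : ℝ)
    (hpos : ∀ x, 0 < g x) (h1 : ∀ x, HasDerivAt g (g' x) x)
    (h2 : ∀ x, HasDerivAt g' (g'' x) x) (x : ℝ) :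
    iteratedDeriv 2 (fun x => K - 2 * Real.log (g x)) x
      = -2 * (g'' x * g x - g' x ^ 2) / g x ^ 2 := by
  have hd : deriv (fun x => K - 2 * Real.log (g x)) = fun x => -(2 * (g' x / g x)) := by
    funext t
    exact ((((h1 t).log (hpos t).ne').const_mul 2).const_sub K).deriv
  have hd' : HasDerivAt (fun x => -(2 * (g' x / g x)))
      (-(2 * ((g'' x * g x - g' x * g' x) / g x ^ 2))) x :=
    (((h2 x).div (h1 x) (hpos x).ne').const_mul 2).neg
  rw [iteratedDeriv_succ, iteratedDeriv_one, hd, hd'.deriv]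
  ring

/-- The function `cosh (a x) + cos (a y) / 2`. -/
noncomputable def coshAddCos (a : ℝ) (p : ℝ × ℝ) : ℝ :=
  Real.cosh (a * p.1) + Real.cos (a * p.2) / 2

theorem half_cosh_le_coshAddCos (a : ℝ) (p : ℝ × ℝ) :
    Real.cosh (a * p.1) / 2 ≤ coshAddCos a p := by
  unfold coshAddCos
  linarith [Real.one_le_cosh (a * p.1), Real.neg_one_le_cos (a * p.2)]

theorem coshAddCos_pos (a : ℝ) (p : ℝ × ℝ) : 0 < coshAddCos a p :=
  (half_pos (Real.cosh_pos _)).trans_le (half_cosh_le_coshAddCos a p)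

theorem contDiff_coshAddCos (a : ℝ) : ContDiff ℝ 2 (coshAddCos a) := by
  unfold coshAddCos
  fun_prop

/-- The solution `log (3 a² / 2) - 2 log (cosh (a x) + cos (a y) / 2)` of Liouville's equation. -/
noncomputable def liouvilleSol (a : ℝ) (p : ℝ × ℝ) : ℝ :=
  Real.log (3 / 2 * a ^ 2) - 2 * Real.log (coshAddCos a p)

theorem contDiff_liouvilleSol (a : ℝ) : ContDiff ℝ 2 (liouvilleSol a) :=
  contDiff_const.sub
    (contDiff_const.mul ((contDiff_coshAddCos a).log fun p => (coshAddCos_pos a p).ne'))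

theorem exp_liouvilleSol {a : ℝ} (ha : 0 < a) (p : ℝ × ℝ) :
    Real.exp (liouvilleSol a p) = 3 / 2 * a ^ 2 / coshAddCos a p ^ 2 := by
  have hD := coshAddCos_pos a p
  rw [liouvilleSol, Real.exp_sub, Real.exp_log (by positivity), mul_comm (2 : ℝ),
    Real.exp_mul, Real.exp_log hD, Real.rpow_two]

theorem lap2_liouvilleSol_add_exp {a : ℝ} (ha : 0 < a) (p : ℝ × ℝ) :
    lap2 (liouvilleSol a) p + Real.exp (liouvilleSol a p) = 0 := by
  obtain ⟨x, y⟩ := p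
  have hlin : ∀ t : ℝ, HasDerivAt (fun t => a * t) a t := fun t => by
    simpa using (hasDerivAt_id t).const_mul a
  have hx := iteratedDeriv_two_const_sub_two_mul_log (g := fun x => coshAddCos a (x, y))
    (g' := fun x => Real.sinh (a * x) * a) (g'' := fun x => Real.cosh (a * x) * a * a)
    (Real.log (3 / 2 * a ^ 2)) (fun x => coshAddCos_pos a (x, y))
    (fun t => ((hlin t).cosh).add_const (Real.cos (a * y) / 2))
    (fun t => ((hlin t).sinh).mul_const a) x
  have hy := iteratedDeriv_two_const_sub_two_mul_log (g := fun y => coshAddCos a (x, y))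
    (g' := fun y => -Real.sin (a * y) * a / 2) (g'' := fun y => -(Real.cos (a * y) * a) * a / 2)
    (Real.log (3 / 2 * a ^ 2)) (fun y => coshAddCos_pos a (x, y))
    (fun t => (((hlin t).cos).div_const 2).const_add (Real.cosh (a * x)))
    (fun t => by simpa using (((hlin t).sin.neg).mul_const a).div_const 2) y
  have hD := coshAddCos_pos a (x, y)
  rw [exp_liouvilleSol ha]
  unfold lap2 liouvilleSol
  simp only at hx hy ⊢
  rw [hx, hy, ← add_div, ← add_div, div_eq_zero_iff]
  left
  unfold coshAddCos
  linear_combination (-2 * a ^ 2) * Real.cosh_sq (a * x)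
    + a ^ 2 / 2 * Real.sin_sq_add_cos_sq (a * y)

theorem liouvilleSol_le {a : ℝ} (p : ℝ × ℝ) :
    liouvilleSol a p ≤ Real.log (3 / 2 * a ^ 2) + 2 * Real.log 4 - 2 * |a * p.1| := by
  have h : Real.exp |a * p.1| / 4 ≤ coshAddCos a p := by
    refine le_trans ?_ (half_cosh_le_coshAddCos a p)
    rw [← Real.cosh_abs, Real.cosh_eq]
    linarith [Real.exp_pos (-|a * p.1|)]
  have hlog := Real.log_le_log (by positivity) h
  rw [Real.log_div (Real.exp_pos _).ne' (by norm_num), Real.log_exp] at hlog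
  unfold liouvilleSol
  linarith

theorem lintegral_exp_liouvilleSol {a : ℝ} (ha : 0 < a) :
    ∫⁻ p : ℝ × ℝ, ENNReal.ofReal (Real.exp (liouvilleSol a p)) = ⊤ := by
  set c : ℝ := 3 / 2 * a ^ 2 / (Real.cosh a + 1 / 2) ^ 2 with hc
  have hcpos : 0 < c := by
    have := Real.cosh_pos a
    positivity
  have hvol : volume (Set.Icc (-1 : ℝ) 1 ×ˢ (Set.univ : Set ℝ)) = ⊤ := by
    rw [Measure.volume_eq_prod, Measure.prod_prod, Real.volume_Icc, Real.volume_univ]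
    exact ENNReal.mul_top (by norm_num)
  rw [eq_top_iff]
  calc ⊤ = ∫⁻ _ in Set.Icc (-1 : ℝ) 1 ×ˢ (Set.univ : Set ℝ), ENNReal.ofReal c := by
        rw [setLIntegral_const, hvol, ENNReal.mul_top (by simpa using hcpos)]
    _ ≤ ∫⁻ p in Set.Icc (-1 : ℝ) 1 ×ˢ (Set.univ : Set ℝ),
          ENNReal.ofReal (Real.exp (liouvilleSol a p)) := by
        refine setLIntegral_mono' (measurableSet_Icc.prod MeasurableSet.univ) fun p hp => ?_
        refine ENNReal.ofReal_le_ofReal ?_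
        have hD := coshAddCos_pos a p
        have hle : coshAddCos a p ≤ Real.cosh a + 1 / 2 := by
          have h1 : Real.cosh (a * p.1) ≤ Real.cosh a := by
            rw [Real.cosh_le_cosh, abs_mul]
            exact mul_le_of_le_one_right (abs_nonneg a) (abs_le.2 hp.1)
          unfold coshAddCos
          linarith [Real.cos_le_one (a * p.2)]
        rw [exp_liouvilleSol ha, hc]
        gcongr
    _ ≤ _ := setLIntegral_le_lintegral _ _

/-- For every positive integer `k` and every `ε > 0` there is a `C²` solution of the 2D Liouville
equation `Δu + e^u = 0` on `ℝ²`, even in `x`, periodic in `y` of some period `T` with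
`πk ≤ T < πk + ε`, genuinely depending on `y`, tending to `-∞` as `|x| → ∞` uniformly in `y`,
and with infinite volume `∫ e^u = ∞`. -/
theorem stmt0 (k : ℕ) (hk : 0 < k) (ε : ℝ) (hε : 0 < ε) :
    ∃ u : ℝ × ℝ → ℝ, ContDiff ℝ 2 u ∧
      (∀ p : ℝ × ℝ, lap2 u p + Real.exp (u p) = 0) ∧
      (∀ x y : ℝ, u (-x, y) = u (x, y)) ∧
      (∃ T : ℝ, Real.pi * k ≤ T ∧ T < Real.pi * k + ε ∧ ∀ x y : ℝ, u (x, y + T) = u (x, y)) ∧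
      (∃ x y₁ y₂ : ℝ, u (x, y₁) ≠ u (x, y₂)) ∧
      (∀ M : ℝ, ∃ R : ℝ, ∀ x y : ℝ, R ≤ |x| → u (x, y) ≤ M) ∧
      ((∫⁻ p : ℝ × ℝ, ENNReal.ofReal (Real.exp (u p))) = ⊤) := by
  have hk' : (0 : ℝ) < k := by exact_mod_cast hk
  obtain ⟨a, ha, hak⟩ : ∃ a : ℝ, 0 < a ∧ a * k = 2 := ⟨2 / k, by positivity, by field_simp⟩
  refine ⟨liouvilleSol a, contDiff_liouvilleSol a, lap2_liouvilleSol_add_exp ha, ?_,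
    ⟨Real.pi * k, le_rfl, by linarith, ?_⟩, ⟨0, 0, Real.pi / a, ?_⟩, ?_,
    lintegral_exp_liouvilleSol ha⟩
  · intro x y
    simp [liouvilleSol, coshAddCos]
  · intro x y
    have h : a * (y + Real.pi * k) = a * y + 2 * Real.pi := by
      linear_combination Real.pi * hak
    simp [liouvilleSol, coshAddCos, h]
  · intro h
    have hexp := congrArg Real.exp h
    rw [exp_liouvilleSol ha, exp_liouvilleSol ha] at hexp
    simp only [coshAddCos, mul_zero, Real.cosh_zero, Real.cos_zero, mul_div_cancel₀ _ ha.ne',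
      Real.cos_pi] at hexp
    norm_num at hexp
    linarith [pow_pos ha 2]
  · intro M
    refine ⟨(Real.log (3 / 2 * a ^ 2) + 2 * Real.log 4 - M) / (2 * a), fun x y hR => ?_⟩
    rw [div_le_iff₀ (by positivity)] at hR
    refine (liouvilleSol_le (x, y)).trans ?_
    rw [abs_mul, abs_of_pos ha]
    linarith
end

section
/- Let X and Y be real Banach spaces, F : ℝ × X → Y of class C^∞ with F(λ,0) = 0 for all λ ∈ ℝ. Let λ : ℝ → ℝ and u : ℝ → X be smooth curves with u(0) = 0 and F(λ(t), u(t)) = 0 for all t in a neighborhood of 0, and write λ₀ := λ(0). Let ψ : Y → ℝ be a continuous linear functional that vanishes on the range of the partial derivative L := ∂F/∂u(λ₀,0). Then (1/2)·ψ(∂²F/∂u²(λ₀,0)[u'(0), u'(0)]) + λ'(0)·ψ(∂²F/∂λ∂u(λ₀,0)[u'(0)]) = 0. In particular, if ψ(∂²F/∂λ∂u(λ₀,0)[u'(0)]) ≠ 0, then λ'(0) = −(1/2)·ψ(∂²F/∂u²(λ₀,0)[u'(0),u'(0)]) / ψ(∂²F/∂λ∂u(λ₀,0)[u'(0)]). 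-/
section PartialDerivatives

variable {X Y : Type*} [NormedAddCommGroup X] [NormedSpace ℝ X]
  [NormedAddCommGroup Y] [NormedSpace ℝ Y] {F : ℝ × X → Y}

theorem fderiv_partial_right (hF : Differentiable ℝ F) (l : ℝ) (v z : X) :
    fderiv ℝ (fun w => F (l, w)) v z = fderiv ℝ F (l, v) (0, z) := by
  have h : HasFDerivAt (fun w => F (l, w))
      ((fderiv ℝ F (l, v)).comp (ContinuousLinearMap.inr ℝ ℝ X)) v :=
    (hF (l, v)).hasFDerivAt.comp v (hasFDerivAt_prodMk_right l v)
  rw [h.fderiv]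
  simp

theorem fderiv_fderiv_partial_right (hF : ContDiff ℝ 2 F) (l : ℝ) (v z y : X) :
    fderiv ℝ (fun v => fderiv ℝ (fun w => F (l, w)) v) v z y
      = fderiv ℝ (fderiv ℝ F) (l, v) (0, z) (0, y) := by
  have hF1 : Differentiable ℝ F := hF.differentiable (by norm_num)
  have hF2 : Differentiable ℝ (fderiv ℝ F) :=
    (hF.fderiv_right (m := 1) (by norm_num)).differentiable (by norm_num)
  have heq : (fun v => fderiv ℝ (fun w => F (l, w)) v) =
      fun v => (fderiv ℝ F (l, v)).comp (ContinuousLinearMap.inr ℝ ℝ X) := by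
    funext v
    ext z
    simp [fderiv_partial_right hF1]
  have h : HasFDerivAt (fun v => fderiv ℝ F (l, v))
      ((fderiv ℝ (fderiv ℝ F) (l, v)).comp (ContinuousLinearMap.inr ℝ ℝ X)) v :=
    (hF2 (l, v)).hasFDerivAt.comp v (hasFDerivAt_prodMk_right l v)
  rw [heq, (h.clm_comp (hasFDerivAt_const (ContinuousLinearMap.inr ℝ ℝ X) v)).fderiv]
  simp

theorem hasDerivAt_fderiv_left (hF : ContDiff ℝ 2 F) (l : ℝ) (v : X) (p : ℝ × X) :
    HasDerivAt (fun l => fderiv ℝ F (l, v) p) (fderiv ℝ (fderiv ℝ F) (l, v) (1, 0) p) l := by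
  have hF2 : Differentiable ℝ (fderiv ℝ F) :=
    (hF.fderiv_right (m := 1) (by norm_num)).differentiable (by norm_num)
  have h : HasDerivAt (fun l => fderiv ℝ F (l, v)) (fderiv ℝ (fderiv ℝ F) (l, v) (1, 0)) l :=
    (hF2 (l, v)).hasFDerivAt.comp_hasDerivAt l ((hasDerivAt_id l).prodMk (hasDerivAt_const l v))
  simpa using h.clm_apply (hasDerivAt_const l p)

theorem deriv_fderiv_partial_right (hF : ContDiff ℝ 2 F) (l : ℝ) (v z : X) :
    deriv (fun l => fderiv ℝ (fun w => F (l, w)) v z) l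
      = fderiv ℝ (fderiv ℝ F) (l, v) (1, 0) (0, z) := by
  simp_rw [fderiv_partial_right (hF.differentiable (by norm_num))]
  exact (hasDerivAt_fderiv_left hF l v (0, z)).deriv

theorem fderiv_trivial_branch (hF : Differentiable ℝ F) (htriv : ∀ l : ℝ, F (l, 0) = 0) (l : ℝ) :
    fderiv ℝ F (l, 0) (1, 0) = 0 := by
  have h : HasDerivAt (fun l : ℝ => F (l, 0)) (fderiv ℝ F (l, 0) (1, 0)) l :=
    (hF (l, 0)).hasFDerivAt.comp_hasDerivAt l
      ((hasDerivAt_id l).prodMk (hasDerivAt_const l (0 : X)))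
  simp_rw [htriv] at h
  exact h.unique (hasDerivAt_const l 0)

theorem fderiv_fderiv_trivial_branch (hF : ContDiff ℝ 2 F) (htriv : ∀ l : ℝ, F (l, 0) = 0)
    (l : ℝ) : fderiv ℝ (fderiv ℝ F) (l, 0) (1, 0) (1, 0) = 0 := by
  have h := hasDerivAt_fderiv_left hF l 0 (1, 0)
  simp_rw [fderiv_trivial_branch (hF.differentiable (by norm_num)) htriv] at h
  exact h.unique (hasDerivAt_const l 0)

end PartialDerivatives

/-- Second-order chain rule along a curve on which `F` vanishes near `t`. -/
theorem fderiv_fderiv_add_fderiv_eq_zero_of_curve {E Y : Type*}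
    [NormedAddCommGroup E] [NormedSpace ℝ E] [NormedAddCommGroup Y] [NormedSpace ℝ Y]
    {F : E → Y} (hF : ContDiff ℝ 2 F) {c : ℝ → E} (hc : ContDiff ℝ 2 c) {t : ℝ}
    (h0 : ∀ᶠ s in nhds t, F (c s) = 0) :
    fderiv ℝ (fderiv ℝ F) (c t) (deriv c t) (deriv c t)
      + fderiv ℝ F (c t) (deriv (deriv c) t) = 0 := by
  have hF1 : Differentiable ℝ F := hF.differentiable (by norm_num)
  have hF2 : Differentiable ℝ (fderiv ℝ F) :=
    (hF.fderiv_right (m := 1) (by norm_num)).differentiable (by norm_num)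
  have hc1 : Differentiable ℝ c := hc.differentiable (by norm_num)
  have hc2 : Differentiable ℝ (deriv c) :=
    (contDiff_succ_iff_deriv.1 (show ContDiff ℝ (1 + 1) c from hc)).2.2.differentiable
      (by norm_num)
  have hfirst : (fun s => fderiv ℝ F (c s) (deriv c s)) =ᶠ[nhds t] fun _ => 0 := by
    filter_upwards [h0.eventually_nhds] with s hs
    have hd : HasDerivAt (fun r => F (c r)) (fderiv ℝ F (c s) (deriv c s)) s :=
      (hF1 (c s)).hasFDerivAt.comp_hasDerivAt s (hc1 s).hasDerivAt
    exact hd.unique ((hasDerivAt_const s (0 : Y)).congr_of_eventuallyEq hs)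
  have hD : HasDerivAt (fun s => fderiv ℝ F (c s))
      (fderiv ℝ (fderiv ℝ F) (c t) (deriv c t)) t :=
    (hF2 (c t)).hasFDerivAt.comp_hasDerivAt t (hc1 t).hasDerivAt
  exact (hD.clm_apply (hc2 t).hasDerivAt).unique
    ((hasDerivAt_const t (0 : Y)).congr_of_eventuallyEq hfirst)


/-- First-order bifurcation coefficient identity. Let `F : ℝ × X → Y` be `C^∞` with
`F(λ,0) = 0` for all `λ`, let `t ↦ (λ(t), u(t))` be a smooth curve of solutions with `u(0) = 0`,
and let `ψ` be a continuous linear functional vanishing on the range of `∂F/∂u(λ(0),0)`. Then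
`(1/2)·ψ(F_uu(λ₀,0)[u'(0),u'(0)]) + λ'(0)·ψ(F_{λu}(λ₀,0)[u'(0)]) = 0`, and if
`ψ(F_{λu}(λ₀,0)[u'(0)]) ≠ 0` then `λ'(0)` is given by the corresponding quotient. -/
theorem stmt3 {X Y : Type*} [NormedAddCommGroup X] [NormedSpace ℝ X]
    [NormedAddCommGroup Y] [NormedSpace ℝ Y]
    (F : ℝ × X → Y) (hF : ContDiff ℝ (⊤ : ℕ∞) F) (htriv : ∀ l : ℝ, F (l, 0) = 0)
    (lam : ℝ → ℝ) (u : ℝ → X)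
    (hlam : ContDiff ℝ (⊤ : ℕ∞) lam) (hu : ContDiff ℝ (⊤ : ℕ∞) u)
    (hu0 : u 0 = 0) (hsol : ∀ᶠ t in nhds (0 : ℝ), F (lam t, u t) = 0)
    (ψ : Y →L[ℝ] ℝ)
    (hψ : ∀ z : X, ψ (fderiv ℝ (fun v => F (lam 0, v)) 0 z) = 0) :
    (1 / 2) *
        ψ (fderiv ℝ (fun v => fderiv ℝ (fun w => F (lam 0, w)) v) 0 (deriv u 0) (deriv u 0))
      + deriv lam 0 *
        ψ (deriv (fun l => fderiv ℝ (fun w => F (l, w)) 0 (deriv u 0)) (lam 0)) = 0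
    ∧ (ψ (deriv (fun l => fderiv ℝ (fun w => F (l, w)) 0 (deriv u 0)) (lam 0)) ≠ 0 →
        deriv lam 0 =
          -(1 / 2) *
            ψ (fderiv ℝ (fun v => fderiv ℝ (fun w => F (lam 0, w)) v) 0 (deriv u 0) (deriv u 0)) /
            ψ (deriv (fun l => fderiv ℝ (fun w => F (l, w)) 0 (deriv u 0)) (lam 0))) := by
  have hF2 : ContDiff ℝ 2 F := contDiff_infty.1 hF 2
  have hF1 : Differentiable ℝ F := hF2.differentiable (by norm_num)
  have hlam2 : ContDiff ℝ 2 lam := contDiff_infty.1 hlam 2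
  have hu2 : ContDiff ℝ 2 u := contDiff_infty.1 hu 2
  have hc' : deriv (fun t => (lam t, u t)) 0 = (deriv lam 0, deriv u 0) :=
    ((hlam2.differentiable (by norm_num) 0).hasDerivAt.prodMk
      (hu2.differentiable (by norm_num) 0).hasDerivAt).deriv
  have hsecond := fderiv_fderiv_add_fderiv_eq_zero_of_curve hF2 (hlam2.prodMk hu2) hsol
  simp only [hc', hu0] at hsecond
  rw [fderiv_fderiv_partial_right hF2, deriv_fderiv_partial_right hF2]
  have hψL : ∀ p : ℝ × X, ψ (fderiv ℝ F (lam 0, 0) p) = 0 := by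
    rintro ⟨a, z⟩
    have hp : ((a, z) : ℝ × X) = a • (1, 0) + (0, z) := by simp
    rw [hp, map_add, map_smul, fderiv_trivial_branch hF1 htriv, ← fderiv_partial_right hF1]
    simp [hψ]
  have hsymm : fderiv ℝ (fderiv ℝ F) (lam 0, 0) (0, deriv u 0) (1, 0)
      = fderiv ℝ (fderiv ℝ F) (lam 0, 0) (1, 0) (0, deriv u 0) :=
    (hF2.contDiffAt.isSymmSndFDerivAt (by simp)).eq _ _
  have hsplit : (deriv lam 0, deriv u 0) = deriv lam 0 • ((1, 0) : ℝ × X) + (0, deriv u 0) := by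
    simp
  have hψsecond := congrArg ψ hsecond
  rw [map_add, hψL, hsplit] at hψsecond
  simp only [map_add, map_smul, add_apply, smul_apply, hsymm,
    fderiv_fderiv_trivial_branch hF2 htriv, smul_eq_mul, map_zero] at hψsecond
  have hmain : (1 / 2) * ψ (fderiv ℝ (fderiv ℝ F) (lam 0, 0) (0, deriv u 0) (0, deriv u 0))
      + deriv lam 0 * ψ (fderiv ℝ (fderiv ℝ F) (lam 0, 0) (1, 0) (0, deriv u 0)) = 0 := by
    linarith
  refine ⟨hmain, fun hne => ?_⟩
  rw [eq_div_iff hne]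
  linarith
end

section
/- Let X and Y be real Banach spaces, F : ℝ × X → Y of class C^∞ with F(λ,0) = 0 for all λ ∈ ℝ. Let λ : ℝ → ℝ and u : ℝ → X be smooth curves with u(0) = 0, λ'(0) = 0, and F(λ(t), u(t)) = 0 for all t in a neighborhood of 0; write λ₀ := λ(0). Let ψ : Y → ℝ be a continuous linear functional vanishing on the range of ∂F/∂u(λ₀,0). Then (1/2)·ψ(∂²F/∂u²(λ₀,0)[u'(0), u''(0)]) + (1/6)·ψ(∂³F/∂u³(λ₀,0)[u'(0), u'(0), u'(0)]) + (λ''(0)/2)·ψ(∂²F/∂λ∂u(λ₀,0)[u'(0)]) = 0. In particular, if ψ(∂²F/∂λ∂u(λ₀,0)[u'(0)]) ≠ 0, then λ''(0)/2 = −( ψ(∂²F/∂u²(λ₀,0)[u'(0), u''(0)/2]) + (1/6)·ψ(∂³F/∂u³(λ₀,0)[u'(0),u'(0),u'(0)]) ) / ψ(∂²F/∂λ∂u(λ₀,0)[u'(0)]); the sign of this quantity discriminates between supercritical (positive) and subcritical (negative) bifurcations. -/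
open ContinuousLinearMap in
theorem fderiv_slice_right {A X W : Type*} [NormedAddCommGroup A] [NormedSpace ℝ A]
    [NormedAddCommGroup X] [NormedSpace ℝ X] [NormedAddCommGroup W] [NormedSpace ℝ W]
    {H : A × X → W} (hH : Differentiable ℝ H) (l : A) (v : X) :
    fderiv ℝ (fun w => H (l, w)) v = (fderiv ℝ H (l, v)).comp (inr ℝ A X) :=
  ((hH (l, v)).hasFDerivAt.comp v (hasFDerivAt_prodMk_right l v)).fderiv

open ContinuousLinearMap in
theorem fderiv_fderiv_slice_right {A X W : Type*} [NormedAddCommGroup A] [NormedSpace ℝ A]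
    [NormedAddCommGroup X] [NormedSpace ℝ X] [NormedAddCommGroup W] [NormedSpace ℝ W]
    {H : A × X → W} (hH : ContDiff ℝ 2 H) (l : A) (v a b : X) :
    fderiv ℝ (fun v => fderiv ℝ (fun w => H (l, w)) v) v a b =
      fderiv ℝ (fderiv ℝ H) (l, v) (0, a) (0, b) := by
  have h1 : Differentiable ℝ (fderiv ℝ H) :=
    (hH.fderiv_right (m := 1) (by norm_num)).differentiable (by norm_num)
  simp_rw [fderiv_slice_right (hH.differentiable (by norm_num))]
  have h2 := ((h1 (l, v)).hasFDerivAt.comp v (hasFDerivAt_prodMk_right l v)).clm_comp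
    (hasFDerivAt_const (inr ℝ A X) v)
  simp only [Function.comp_apply] at h2
  rw [h2.fderiv]
  simp

open ContinuousLinearMap in
theorem fderiv_fderiv_fderiv_slice_right {A X W : Type*} [NormedAddCommGroup A] [NormedSpace ℝ A]
    [NormedAddCommGroup X] [NormedSpace ℝ X] [NormedAddCommGroup W] [NormedSpace ℝ W]
    {H : A × X → W} (hH : ContDiff ℝ 3 H) (l : A) (v a b c : X) :
    fderiv ℝ (fun v => fderiv ℝ (fun w => fderiv ℝ (fun z => H (l, z)) w) v) v a b c =
      fderiv ℝ (fderiv ℝ (fderiv ℝ H)) (l, v) (0, a) (0, b) (0, c) := by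
  have h2 : ContDiff ℝ 2 (fderiv ℝ H) := hH.fderiv_right (by norm_num)
  let L : (A × X →L[ℝ] W) →L[ℝ] (X →L[ℝ] W) := (compL ℝ X (A × X) W).flip (inr ℝ A X)
  have h3 : ContDiff ℝ 2 (fun p => L (fderiv ℝ H p)) := L.contDiff.comp h2
  have hL : fderiv ℝ (fun p => L (fderiv ℝ H p)) = fun p => L.comp (fderiv ℝ (fderiv ℝ H) p) := by
    funext p
    exact (L.hasFDerivAt.comp p (h2.differentiable (by norm_num) p).hasFDerivAt).fderiv
  have h4 : Differentiable ℝ (fderiv ℝ (fderiv ℝ H)) :=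
    (h2.fderiv_right (m := 1) (by norm_num)).differentiable (by norm_num)
  have h5 : (fun w => fderiv ℝ (fun z => H (l, z)) w) = fun w => L (fderiv ℝ H (l, w)) := by
    funext w
    exact fderiv_slice_right (hH.differentiable (by norm_num)) l w
  rw [h5, fderiv_fderiv_slice_right (H := fun p => L (fderiv ℝ H p)) h3, hL]
  have h6 := (hasFDerivAt_const L (l, v)).clm_comp (h4 (l, v)).hasFDerivAt
  rw [HasFDerivAt.fderiv h6]
  simp [L]

theorem hasDerivAt_prodMk_left_comp {X W : Type*} [NormedAddCommGroup X] [NormedSpace ℝ X]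
    [NormedAddCommGroup W] [NormedSpace ℝ W] {H : ℝ × X → W} (hH : Differentiable ℝ H)
    (l : ℝ) (v : X) : HasDerivAt (fun l => H (l, v)) (fderiv ℝ H (l, v) (1, 0)) l :=
  HasFDerivAt.comp_hasDerivAt (f := fun l => (l, v)) l (hH (l, v)).hasFDerivAt
    ((hasDerivAt_id l).prodMk (hasDerivAt_const l v))

/-- The third derivative along a curve of a function vanishing on that curve. -/
theorem third_deriv_comp_curve_eq_zero {E Y : Type*} [NormedAddCommGroup E] [NormedSpace ℝ E]
    [NormedAddCommGroup Y] [NormedSpace ℝ Y] {F : E → Y} (hF : ContDiff ℝ 3 F)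
    {c : ℝ → E} (hc : ContDiff ℝ 3 c) {s : ℝ} (h : ∀ᶠ t in nhds s, F (c t) = 0) :
    fderiv ℝ (fderiv ℝ (fderiv ℝ F)) (c s) (deriv c s) (deriv c s) (deriv c s)
      + (3 : ℝ) • fderiv ℝ (fderiv ℝ F) (c s) (deriv (deriv c) s) (deriv c s)
      + fderiv ℝ F (c s) (deriv (deriv (deriv c)) s) = 0 := by
  have hF2 : ContDiff ℝ 2 (fderiv ℝ F) := hF.fderiv_right (by norm_num)
  have hF3 : ContDiff ℝ 1 (fderiv ℝ (fderiv ℝ F)) := hF2.fderiv_right (by norm_num)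
  have hc1 : ContDiff ℝ 2 (deriv c) :=
    (contDiff_succ_iff_deriv (n := 2).1 (by norm_num; exact hc)).2.2
  have hc2 : ContDiff ℝ 1 (deriv (deriv c)) :=
    (contDiff_succ_iff_deriv (n := 1).1 (by norm_num; exact hc1)).2.2
  have d0 (t) : HasDerivAt c (deriv c t) t := (hc.differentiable (by norm_num) t).hasDerivAt
  have d1 (t) : HasDerivAt (deriv c) (deriv (deriv c) t) t :=
    (hc1.differentiable (by norm_num) t).hasDerivAt
  have d2 (t) : HasDerivAt (deriv (deriv c)) (deriv (deriv (deriv c)) t) t :=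
    (hc2.differentiable (by norm_num) t).hasDerivAt
  have e0 (t) := (hF.differentiable (by norm_num) (c t)).hasFDerivAt.comp_hasDerivAt t (d0 t)
  have e1 (t) := (hF2.differentiable (by norm_num) (c t)).hasFDerivAt.comp_hasDerivAt t (d0 t)
  have e2 (t) := (hF3.differentiable (by norm_num) (c t)).hasFDerivAt.comp_hasDerivAt t (d0 t)
  have zero_deriv {g g' : ℝ → Y} (hg : ∀ t, HasDerivAt g (g' t) t)
      (hz : g =ᶠ[nhds s] fun _ => 0) : g' =ᶠ[nhds s] fun _ => 0 := by
    have := hz.deriv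
    rw [funext fun t => (hg t).deriv] at this
    simpa using this
  have z1 := zero_deriv e0 h
  have z2 := zero_deriv (fun t => (e1 t).clm_apply (d1 t)) z1
  have z3 := zero_deriv (fun t => (((e2 t).clm_apply (d1 t)).clm_apply (d1 t)).add
    ((e1 t).clm_apply (d2 t))) z2
  have sym := (hF.contDiffAt (x := c s)).isSymmSndFDerivAt (by simp; norm_num)
  have := z3.self_of_nhds
  simp only [Function.comp_apply, _root_.add_apply] at this
  rw [sym (deriv c s) (deriv (deriv c) s)] at this
  rw [← this]
  module

/-- Second-order bifurcation coefficient identity (corrected formula for `λ₂ = λ''(0)/2`).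
Let `F : ℝ × X → Y` be `C^∞` with `F(λ,0) = 0` for all `λ`, let `t ↦ (λ(t), u(t))` be a smooth
curve of solutions with `u(0) = 0` and `λ'(0) = 0`, and let `ψ` be a continuous linear
functional vanishing on the range of `∂F/∂u(λ(0),0)`. Then
`(1/2)·ψ(F_uu[u'(0),u''(0)]) + (1/6)·ψ(F_uuu[u'(0),u'(0),u'(0)]) + (λ''(0)/2)·ψ(F_{λu}[u'(0)]) = 0`,
and if `ψ(F_{λu}[u'(0)]) ≠ 0` then `λ''(0)/2` is given by the corresponding quotient
(involving `u₂ = u''(0)/2`). -/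
theorem stmt4 {X Y : Type*} [NormedAddCommGroup X] [NormedSpace ℝ X]
    [NormedAddCommGroup Y] [NormedSpace ℝ Y]
    (F : ℝ × X → Y) (hF : ContDiff ℝ (⊤ : ℕ∞) F) (htriv : ∀ l : ℝ, F (l, 0) = 0)
    (lam : ℝ → ℝ) (u : ℝ → X)
    (hlam : ContDiff ℝ (⊤ : ℕ∞) lam) (hu : ContDiff ℝ (⊤ : ℕ∞) u)
    (hu0 : u 0 = 0) (hlam' : deriv lam 0 = 0)
    (hsol : ∀ᶠ t in nhds (0 : ℝ), F (lam t, u t) = 0)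
    (ψ : Y →L[ℝ] ℝ)
    (hψ : ∀ z : X, ψ (fderiv ℝ (fun v => F (lam 0, v)) 0 z) = 0) :
    (1 / 2) *
        ψ (fderiv ℝ (fun v => fderiv ℝ (fun w => F (lam 0, w)) v) 0 (deriv u 0)
            (deriv (deriv u) 0))
      + (1 / 6) *
        ψ (fderiv ℝ (fun v => fderiv ℝ (fun w => fderiv ℝ (fun z => F (lam 0, z)) w) v) 0
            (deriv u 0) (deriv u 0) (deriv u 0))
      + (deriv (deriv lam) 0 / 2) *
        ψ (deriv (fun l => fderiv ℝ (fun w => F (l, w)) 0 (deriv u 0)) (lam 0)) = 0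
    ∧ (ψ (deriv (fun l => fderiv ℝ (fun w => F (l, w)) 0 (deriv u 0)) (lam 0)) ≠ 0 →
        deriv (deriv lam) 0 / 2 =
          -(ψ (fderiv ℝ (fun v => fderiv ℝ (fun w => F (lam 0, w)) v) 0 (deriv u 0)
                ((1 / 2 : ℝ) • deriv (deriv u) 0))
            + (1 / 6) *
              ψ (fderiv ℝ (fun v => fderiv ℝ (fun w => fderiv ℝ (fun z => F (lam 0, z)) w) v) 0
                  (deriv u 0) (deriv u 0) (deriv u 0))) /
            ψ (deriv (fun l => fderiv ℝ (fun w => F (l, w)) 0 (deriv u 0)) (lam 0))) := by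
  have hF3 : ContDiff ℝ 3 F := contDiff_infty.1 hF 3
  have hl3 : ContDiff ℝ 3 lam := contDiff_infty.1 hlam 3
  have hu3 : ContDiff ℝ 3 u := contDiff_infty.1 hu 3
  have hF2 : ContDiff ℝ 2 F := hF3.of_le (by norm_num)
  have hl2 : ContDiff ℝ 2 (deriv lam) :=
    (contDiff_succ_iff_deriv (n := 2).1 (by norm_num; exact hl3)).2.2
  have hu2 : ContDiff ℝ 2 (deriv u) :=
    (contDiff_succ_iff_deriv (n := 2).1 (by norm_num; exact hu3)).2.2
  have hdF : Differentiable ℝ F := hF2.differentiable (by norm_num)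
  have hdF' : Differentiable ℝ (fderiv ℝ F) :=
    (hF2.fderiv_right (m := 1) (by norm_num)).differentiable (by norm_num)
  have c1 : deriv (fun t => (lam t, u t)) = fun t => (deriv lam t, deriv u t) := by
    funext t
    exact ((hl3.differentiable (by norm_num) t).hasDerivAt.prodMk
      (hu3.differentiable (by norm_num) t).hasDerivAt).deriv
  have c2 : deriv (fun t => (deriv lam t, deriv u t)) 0 =
      (deriv (deriv lam) 0, deriv (deriv u) 0) :=
    ((hl2.differentiable (by norm_num) 0).hasDerivAt.prodMk
      (hu2.differentiable (by norm_num) 0).hasDerivAt).deriv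
  have hmix : deriv (fun l => fderiv ℝ (fun w => F (l, w)) 0 (deriv u 0)) (lam 0) =
      fderiv ℝ (fderiv ℝ F) (lam 0, 0) (1, 0) (0, deriv u 0) := by
    have h := (hasDerivAt_prodMk_left_comp hdF' (lam 0) (0 : X)).clm_apply
      (hasDerivAt_const (lam 0) ((0 : ℝ), deriv u 0))
    simp_rw [fderiv_slice_right hdF, ContinuousLinearMap.comp_apply,
      ContinuousLinearMap.inr_apply]
    rw [h.deriv, map_zero, add_zero]
  have hker (p : ℝ × X) : ψ (fderiv ℝ F (lam 0, 0) p) = 0 := by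
    have hx : fderiv ℝ F (lam 0, 0) (0, p.2) = fderiv ℝ (fun v => F (lam 0, v)) 0 p.2 := by
      simp [fderiv_slice_right hdF]
    have hl : fderiv ℝ F (lam 0, 0) (1, 0) = 0 := by
      rw [← (hasDerivAt_prodMk_left_comp hdF (lam 0) (0 : X)).deriv]
      simp [htriv]
    have hp : p = p.1 • ((1 : ℝ), (0 : X)) + (0, p.2) := by ext <;> simp
    rw [hp, map_add, map_smul, hl, hx]
    simp [hψ]
  have key := congrArg ψ (third_deriv_comp_curve_eq_zero hF3 (hl3.prodMk hu3) hsol)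
  have hsplit : (deriv (deriv lam) 0, deriv (deriv u) 0) =
      deriv (deriv lam) 0 • ((1 : ℝ), (0 : X)) + (0, deriv (deriv u) 0) := by ext <;> simp
  have sym := (hF2.contDiffAt (x := (lam 0, (0 : X)))).isSymmSndFDerivAt (by simp)
  simp only [c1, c2, hu0, hlam', map_add, map_smul, hker, map_zero] at key
  rw [hsplit] at key
  simp only [map_add, map_smul, _root_.add_apply, _root_.smul_apply,
    smul_eq_mul] at key
  rw [sym (0, deriv (deriv u) 0) (0, deriv u 0)] at key
  rw [fderiv_fderiv_fderiv_slice_right hF3, map_smul, map_smul, fderiv_fderiv_slice_right hF2,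
    hmix, smul_eq_mul]
  refine ⟨by linarith, fun hne => ?_⟩
  rw [eq_div_iff hne]
  linarith
end

section
/- Let v : ℝ → ℝ be a C² function satisfying v''(x) + 2 sech²(x)·v(x) = 0 for all x ∈ ℝ. If v is even (v(−x) = v(x) for all x) and v has sublinear growth, i.e. v(x)/x → 0 as x → +∞, then v is identically zero. -/
/-- The derivative of `tanh` is `1 - tanh²`. -/
theorem hasDerivAt_tanh_one_sub_sq (x : ℝ) :
    HasDerivAt Real.tanh (1 - Real.tanh x ^ 2) x := by
  have hc : Real.cosh x ≠ 0 := (Real.cosh_pos x).ne'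
  have h := (Real.hasDerivAt_sinh x).div (Real.hasDerivAt_cosh x) hc
  have hfun : Real.tanh = Real.sinh / Real.cosh := funext Real.tanh_eq_sinh_div_cosh
  rw [← hfun] at h
  refine h.congr_deriv ?_
  rw [Real.tanh_eq_sinh_div_cosh]
  field_simp

/-- `sech² = 1 - tanh²`. -/
theorem one_div_cosh_sq (x : ℝ) : (1 / Real.cosh x) ^ 2 = 1 - Real.tanh x ^ 2 := by
  have hc : Real.cosh x ≠ 0 := (Real.cosh_pos x).ne'
  rw [Real.tanh_eq_sinh_div_cosh]
  field_simp
  linarith [Real.cosh_sq x]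

/-- The Wronskian of two solutions of `u'' = q u` is constant. -/
theorem wronskian_eq_of_hasDerivAt {q f f' g g' : ℝ → ℝ}
    (hf : ∀ x, HasDerivAt f (f' x) x) (hf' : ∀ x, HasDerivAt f' (q x * f x) x)
    (hg : ∀ x, HasDerivAt g (g' x) x) (hg' : ∀ x, HasDerivAt g' (q x * g x) x) (x y : ℝ) :
    f x * g' x - f' x * g x = f y * g' y - f' y * g y := by
  have h : ∀ z, HasDerivAt (fun z => f z * g' z - f' z * g z) 0 z := fun z => by
    refine HasDerivAt.congr_deriv (((hf z).mul (hg' z)).sub ((hf' z).mul (hg z))) ?_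
    ring
  exact is_const_of_deriv_eq_zero (fun z => (h z).differentiableAt) (fun z => (h z).deriv) x y

theorem half_le_tanh {x : ℝ} (hx : 2 ≤ x) : 1 / 2 ≤ Real.tanh x := by
  rw [Real.tanh_eq_sinh_div_cosh, le_div_iff₀ (Real.cosh_pos x), Real.sinh_eq, Real.cosh_eq]
  have h₁ := Real.add_one_le_exp x
  have h₂ : Real.exp (-x) ≤ 1 := Real.exp_le_one_iff.mpr (by linarith)
  linarith

/-- An even solution of `v'' + 2 sech² v = 0` is a multiple of `1 - x tanh x`. -/
theorem even_solution_eq (v : ℝ → ℝ) (hv : ContDiff ℝ 2 v)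
    (hode : ∀ x : ℝ, deriv (deriv v) x + 2 * (1 / Real.cosh x) ^ 2 * v x = 0)
    (heven : ∀ x : ℝ, v (-x) = v x) (x : ℝ) :
    v x = v 0 * (1 - x * Real.tanh x) := by
  have hd : ∀ y, HasDerivAt v (deriv v y) y := fun y =>
    (hv.differentiable (by norm_num) y).hasDerivAt
  have hdd : ∀ y, HasDerivAt (deriv v) (-2 * (1 - Real.tanh y ^ 2) * v y) y := fun y => by
    have hv' : ContDiff ℝ 1 (deriv v) := hv.deriv' (n := 1)
    have h := (hv'.differentiable (by norm_num) y).hasDerivAt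
    refine HasDerivAt.congr_deriv h ?_
    have := hode y
    rw [one_div_cosh_sq] at this
    linarith
  have hv0 : deriv v 0 = 0 := by
    have h : HasDerivAt (fun y => v (-y)) (-deriv v 0) 0 := by
      have h0 : HasDerivAt v (deriv v 0) (-0) := by simpa using hd 0
      exact (h0.comp (0 : ℝ) (hasDerivAt_neg (0 : ℝ))).congr_deriv (by ring)
    simp only [heven] at h
    linarith [h.unique (hd 0)]
  have ht' : ∀ y, HasDerivAt (fun y => 1 - Real.tanh y ^ 2)
      (-2 * (1 - Real.tanh y ^ 2) * Real.tanh y) y := fun y => by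
    refine HasDerivAt.congr_deriv (((hasDerivAt_tanh_one_sub_sq y).pow 2).const_sub 1) ?_
    ring
  have hw : ∀ y, HasDerivAt (fun y => 1 - y * Real.tanh y)
      (-Real.tanh y - y * (1 - Real.tanh y ^ 2)) y := fun y => by
    refine HasDerivAt.congr_deriv (((hasDerivAt_id y).mul (hasDerivAt_tanh_one_sub_sq y)).const_sub 1) ?_
    simp only [id]
    ring
  have hw' : ∀ y, HasDerivAt (fun y => -Real.tanh y - y * (1 - Real.tanh y ^ 2))
      (-2 * (1 - Real.tanh y ^ 2) * (1 - y * Real.tanh y)) y := fun y => by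
    refine HasDerivAt.congr_deriv ((hasDerivAt_tanh_one_sub_sq y).neg.sub ((hasDerivAt_id y).mul (ht' y))) ?_
    simp only [id]
    ring
  have h₁ := wronskian_eq_of_hasDerivAt hd hdd hasDerivAt_tanh_one_sub_sq ht' x 0
  have h₂ := wronskian_eq_of_hasDerivAt hd hdd hw hw' x 0
  simp only [hv0, Real.tanh_zero] at h₁ h₂
  linear_combination (1 - x * Real.tanh x) * h₁ - Real.tanh x * h₂

/-- If `v : ℝ → ℝ` is `C²`, solves `v'' + 2 sech²(x) v = 0` on `ℝ`, is even, and has sublinear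
growth (`v(x)/x → 0` as `x → +∞`), then `v ≡ 0`. -/
theorem stmt8 (v : ℝ → ℝ) (hv : ContDiff ℝ 2 v)
    (hode : ∀ x : ℝ, deriv (deriv v) x + 2 * (1 / Real.cosh x) ^ 2 * v x = 0)
    (heven : ∀ x : ℝ, v (-x) = v x)
    (hsub : Filter.Tendsto (fun x : ℝ => v x / x) Filter.atTop (nhds 0)) :
    ∀ x : ℝ, v x = 0 := by
  have hsol := even_solution_eq v hv hode heven
  have hle : |v 0| * (1 / 4) ≤ 0 := by
    have hlim : Filter.Tendsto (fun x : ℝ => |v x / x|) Filter.atTop (nhds 0) := by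
      simpa using hsub.abs
    refine ge_of_tendsto hlim ?_
    filter_upwards [Filter.eventually_ge_atTop (4 : ℝ)] with x hx
    have hx0 : 0 < x := by linarith
    have ht := half_le_tanh (x := x) (by linarith)
    rw [hsol x, abs_div, abs_mul, abs_of_pos hx0, mul_div_assoc]
    refine mul_le_mul_of_nonneg_left ?_ (abs_nonneg _)
    rw [le_div_iff₀ hx0]
    refine le_trans ?_ (neg_le_abs _)
    nlinarith
  have hv0 : v 0 = 0 := abs_eq_zero.mp (le_antisymm (by linarith) (abs_nonneg _))
  intro x
  rw [hsol x, hv0, zero_mul]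
end

section
/- For every ε > 0 there exists a continuous function u : ℝ³ → ℝ such that: (i) u is radial, i.e. u(x) depends only on the Euclidean norm |x|; (ii) sup_{x∈ℝ³} |u(x)|/(1+|x|) < +∞; and (iii) for every x ∈ ℝ³ the integral ∫_{ℝ³} |x−y| e^{−ε|y|²} e^{u(y)} dy converges and u(x) = −(1/(8π)) ∫_{ℝ³} |x−y| e^{−ε|y|²} e^{u(y)} dy. -/
open MeasureTheory

/-- The potential of the density `w` with respect to `μ`, for the kernel `‖x - y‖`. -/
noncomputable def normPotential {E : Type*} [NormedAddCommGroup E] [MeasurableSpace E]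
    (μ : Measure E) (w : E → ℝ) (x : E) : ℝ :=
  ∫ y, ‖x - y‖ * w y ∂μ

/-- The constant `μ(E) + ∫ ‖y‖ dμ(y)`, which controls both the growth and the Lipschitz constant
of potentials of densities bounded by one. -/
noncomputable def normPotentialBound {E : Type*} [NormedAddCommGroup E] [MeasurableSpace E]
    (μ : Measure E) : ℝ :=
  μ.real Set.univ + ∫ y, ‖y‖ ∂μ

section Potential

variable {E : Type*} [NormedAddCommGroup E] [MeasurableSpace E] {μ : Measure E}

lemma normPotentialBound_nonneg : 0 ≤ normPotentialBound μ :=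
  add_nonneg measureReal_nonneg (integral_nonneg fun _ => norm_nonneg _)

lemma abs_normPotential_le [IsFiniteMeasure μ] (hμ : Integrable (fun y => ‖y‖) μ) {w : E → ℝ}
    (hw1 : ∀ x, |w x| ≤ 1) (x : E) :
    |normPotential μ w x| ≤ normPotentialBound μ * (1 + ‖x‖) := by
  have h : ‖∫ y, ‖x - y‖ * w y ∂μ‖ ≤ ∫ y, (‖x‖ + ‖y‖) ∂μ := by
    refine norm_integral_le_of_norm_le ((integrable_const ‖x‖).add hμ) (.of_forall fun y => ?_)
    rw [norm_mul, norm_norm, Real.norm_eq_abs]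
    calc ‖x - y‖ * |w y| ≤ ‖x - y‖ * 1 := by gcongr; exact hw1 y
      _ ≤ ‖x‖ + ‖y‖ := by rw [mul_one]; exact norm_sub_le x y
  rw [integral_add (integrable_const _) hμ, integral_const, smul_eq_mul, Real.norm_eq_abs] at h
  have h1 : 0 ≤ ∫ y, ‖y‖ ∂μ := integral_nonneg fun _ => norm_nonneg _
  have h2 : 0 ≤ μ.real Set.univ := measureReal_nonneg
  have h3 := norm_nonneg x
  unfold normPotential normPotentialBound
  nlinarith [mul_nonneg h1 h3]

variable [BorelSpace E] [SecondCountableTopology E] [IsFiniteMeasure μ]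

lemma integrable_norm_sub_mul (hμ : Integrable (fun y => ‖y‖) μ) {w : E → ℝ}
    (hw : Continuous w) (hw1 : ∀ x, |w x| ≤ 1) (x : E) :
    Integrable (fun y => ‖x - y‖ * w y) μ := by
  refine ((integrable_const ‖x‖).add hμ).mono' (by fun_prop) (.of_forall fun y => ?_)
  rw [norm_mul, norm_norm, Real.norm_eq_abs]
  calc ‖x - y‖ * |w y| ≤ ‖x - y‖ * 1 := by gcongr; exact hw1 y
    _ ≤ ‖x‖ + ‖y‖ := by rw [mul_one]; exact norm_sub_le x y

lemma abs_normPotential_sub_le (hμ : Integrable (fun y => ‖y‖) μ) {w : E → ℝ}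
    (hw : Continuous w) (hw1 : ∀ x, |w x| ≤ 1) (x x' : E) :
    |normPotential μ w x - normPotential μ w x'| ≤ normPotentialBound μ * ‖x - x'‖ := by
  unfold normPotential normPotentialBound
  rw [← integral_sub (integrable_norm_sub_mul hμ hw hw1 x) (integrable_norm_sub_mul hμ hw hw1 x')]
  have h : ‖∫ y, (‖x - y‖ * w y - ‖x' - y‖ * w y) ∂μ‖ ≤ ∫ _, ‖x - x'‖ ∂μ := by
    refine norm_integral_le_of_norm_le (integrable_const _) (.of_forall fun y => ?_)
    rw [← sub_mul, norm_mul, Real.norm_eq_abs, Real.norm_eq_abs]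
    calc |‖x - y‖ - ‖x' - y‖| * |w y| ≤ |‖x - y‖ - ‖x' - y‖| * 1 := by gcongr; exact hw1 y
      _ ≤ ‖x - x'‖ := by
        rw [mul_one]
        simpa using abs_norm_sub_norm_le (x - y) (x' - y)
  rw [integral_const, smul_eq_mul, Real.norm_eq_abs] at h
  have h1 : 0 ≤ ∫ y, ‖y‖ ∂μ := integral_nonneg fun _ => norm_nonneg _
  nlinarith [mul_nonneg h1 (norm_nonneg (x - x'))]

lemma continuous_normPotential (hμ : Integrable (fun y => ‖y‖) μ) {w : E → ℝ}
    (hw : Continuous w) (hw1 : ∀ x, |w x| ≤ 1) : Continuous (normPotential μ w) :=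
  (LipschitzWith.of_dist_le_mul (K := ⟨normPotentialBound μ, normPotentialBound_nonneg⟩)
    fun x y => by
      rw [Real.dist_eq, dist_eq_norm]
      exact abs_normPotential_sub_le hμ hw hw1 x y).continuous

lemma integrable_mul_normPotential (hμ : Integrable (fun y => ‖y‖) μ) {f g : E → ℝ}
    (hf : Continuous f) (hf1 : ∀ x, |f x| ≤ 1) (hg : Continuous g) (hg1 : ∀ x, |g x| ≤ 1) :
    Integrable (fun x => f x * normPotential μ g x) μ := by
  have hP := continuous_normPotential hμ hg hg1
  refine (((integrable_const (1 : ℝ)).add hμ).const_mul (normPotentialBound μ)).mono'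
    (by fun_prop) (.of_forall fun x => ?_)
  rw [norm_mul, Real.norm_eq_abs, Real.norm_eq_abs]
  calc |f x| * |normPotential μ g x| ≤ 1 * (normPotentialBound μ * (1 + ‖x‖)) := by
        gcongr
        · exact hf1 x
        · exact abs_normPotential_le hμ hg1 x
    _ = _ := by simp

lemma integral_mul_normPotential_comm (hμ : Integrable (fun y => ‖y‖) μ) {f g : E → ℝ}
    (hf : Continuous f) (hf1 : ∀ x, |f x| ≤ 1) (hg : Continuous g) (hg1 : ∀ x, |g x| ≤ 1) :
    ∫ x, f x * normPotential μ g x ∂μ = ∫ x, g x * normPotential μ f x ∂μ := by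
  have hint : Integrable (fun z : E × E => f z.1 * (‖z.1 - z.2‖ * g z.2)) (μ.prod μ) := by
    have h1 : Integrable (fun z : E × E => ‖z.1‖ + ‖z.2‖) (μ.prod μ) :=
      (hμ.comp_fst μ).add (hμ.comp_snd μ)
    refine h1.mono' (by fun_prop) (.of_forall fun z => ?_)
    rw [norm_mul, norm_mul, norm_norm, Real.norm_eq_abs, Real.norm_eq_abs]
    calc |f z.1| * (‖z.1 - z.2‖ * |g z.2|) ≤ 1 * (‖z.1 - z.2‖ * 1) := by
          gcongr
          · exact hf1 _
          · exact hg1 _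
      _ ≤ ‖z.1‖ + ‖z.2‖ := by rw [one_mul, mul_one]; exact norm_sub_le _ _
  simp only [normPotential, ← integral_const_mul]
  rw [integral_integral_swap hint]
  congr! 4 with y x
  rw [norm_sub_rev]
  ring

lemma normPotential_add_const_mul (hμ : Integrable (fun y => ‖y‖) μ) {f g : E → ℝ}
    (hf : Continuous f) (hf1 : ∀ x, |f x| ≤ 1) (hg : Continuous g) (hg1 : ∀ x, |g x| ≤ 1)
    (t : ℝ) (x : E) :
    normPotential μ (fun y => f y + t * g y) x
      = normPotential μ f x + t * normPotential μ g x := by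
  simp only [normPotential]
  rw [← integral_const_mul, ← integral_add (integrable_norm_sub_mul hμ hf hf1 x)
    ((integrable_norm_sub_mul hμ hg hg1 x).const_mul t)]
  congr! 2 with y
  ring

lemma integral_add_mul_normPotential (hμ : Integrable (fun y => ‖y‖) μ) {f g : E → ℝ}
    (hf : Continuous f) (hf1 : ∀ x, |f x| ≤ 1) (hg : Continuous g) (hg1 : ∀ x, |g x| ≤ 1)
    (t : ℝ) :
    ∫ x, (f x + t * g x) * normPotential μ (fun y => f y + t * g y) x ∂μ
      = ∫ x, f x * normPotential μ f x ∂μ + 2 * t * ∫ x, g x * normPotential μ f x ∂μ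
        + t ^ 2 * ∫ x, g x * normPotential μ g x ∂μ := by
  have h1 := integrable_mul_normPotential hμ hf hf1 hf hf1
  have h2 := integrable_mul_normPotential hμ hg hg1 hf hf1
  have h3 := integrable_mul_normPotential hμ hf hf1 hg hg1
  have h4 := integrable_mul_normPotential hμ hg hg1 hg hg1
  have h5 := integral_mul_normPotential_comm hμ hf hf1 hg hg1
  calc _ = ∫ x, ((f x * normPotential μ f x + t * (g x * normPotential μ f x))
        + (t * (f x * normPotential μ g x) + t ^ 2 * (g x * normPotential μ g x))) ∂μ := by
        congr! 2 with x
        rw [normPotential_add_const_mul hμ hf hf1 hg hg1]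
        ring
    _ = _ := by
        have h12 : Integrable
            (fun x => f x * normPotential μ f x + t * (g x * normPotential μ f x)) μ :=
          h1.add (h2.const_mul _)
        have h34 : Integrable
            (fun x => t * (f x * normPotential μ g x) + t ^ 2 * (g x * normPotential μ g x)) μ :=
          (h3.const_mul _).add (h4.const_mul _)
        rw [integral_add h12 h34, integral_add h1 (h2.const_mul _),
          integral_add (h3.const_mul _) (h4.const_mul _)]
        simp only [integral_const_mul]
        rw [h5]
        ring

end Potential

section Admissible

variable {E : Type*} [NormedAddCommGroup E] [MeasurableSpace E]

/-- The radial densities with values in `[exp (-A (1 + ‖x‖)), 1]` that are `A`-Lipschitz, where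
`A = normPotentialBound μ`. -/
def admissibleDensities (μ : Measure E) : Set C(E, ℝ) :=
  {w | ∀ x y, Real.exp (-(normPotentialBound μ * (1 + ‖x‖))) ≤ w x ∧ w x ≤ 1 ∧
    |w x - w y| ≤ normPotentialBound μ * ‖x - y‖ ∧ (‖x‖ = ‖y‖ → w x = w y)}

/-- The free energy: entropy plus interaction energy. -/
noncomputable def freeEnergy (μ : Measure E) (w : E → ℝ) : ℝ :=
  ∫ x, (w x * Real.log (w x) - w x) ∂μ + 1 / 2 * ∫ x, w x * normPotential μ w x ∂μ

variable {μ : Measure E}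

lemma admissibleDensities_pos {w : C(E, ℝ)} (hw : w ∈ admissibleDensities μ) (x : E) : 0 < w x :=
  (Real.exp_pos _).trans_le (hw x x).1

lemma admissibleDensities_abs_le_one {w : C(E, ℝ)} (hw : w ∈ admissibleDensities μ) (x : E) :
    |w x| ≤ 1 := by
  rw [abs_of_pos (admissibleDensities_pos hw x)]
  exact (hw x x).2.1

lemma isCompact_admissibleDensities : IsCompact (admissibleDensities μ) := by
  set A := normPotentialBound μ with hA
  have hA0 : 0 ≤ A := normPotentialBound_nonneg
  refine ArzelaAscoli.isCompact_of_equicontinuous _ ?_ ?_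
  · have himage : ContinuousMap.toFun '' admissibleDensities μ =
        {f : E → ℝ | ∀ x y, Real.exp (-(A * (1 + ‖x‖))) ≤ f x ∧ f x ≤ 1 ∧
          |f x - f y| ≤ A * ‖x - y‖ ∧ (‖x‖ = ‖y‖ → f x = f y)} := by
      ext f
      constructor
      · rintro ⟨w, hw, rfl⟩
        exact hw
      · intro hf
        have hc : Continuous f :=
          (LipschitzWith.of_dist_le_mul (K := ⟨A, hA0⟩) fun x y => by
            rw [Real.dist_eq, dist_eq_norm]
            exact (hf x y).2.2.1).continuous
        exact ⟨⟨f, hc⟩, hf, rfl⟩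
    rw [himage]
    refine (isCompact_univ_pi fun _ : E => isCompact_Icc (a := (0 : ℝ)) (b := 1)).of_isClosed_subset
      ?_ fun f hf x _ => ⟨(Real.exp_pos _).le.trans (hf x x).1, (hf x x).2.1⟩
    simp only [Set.ofPred_forall, Set.ofPred_and]
    refine isClosed_iInter fun x => isClosed_iInter fun y => ?_
    refine (isClosed_le (by fun_prop) (by fun_prop)).inter <|
      (isClosed_le (by fun_prop) (by fun_prop)).inter <|
      (isClosed_le (by fun_prop) (by fun_prop)).inter <|
      isClosed_iInter fun _ => isClosed_eq (by fun_prop) (by fun_prop)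
  · refine Metric.equicontinuous_of_continuity_modulus (fun r => A * r) ?_ _ fun x y w => ?_
    · have : Continuous fun r : ℝ => A * r := by fun_prop
      simpa using this.tendsto 0
    · rw [Real.dist_eq, dist_eq_norm]
      exact (w.2 x y).2.2.1

lemma norm_mul_log_sub_self_le {s : ℝ} (h0 : 0 < s) (h1 : s ≤ 1) : ‖s * Real.log s - s‖ ≤ 1 := by
  have h2 := mul_le_mul_of_nonneg_left (Real.one_sub_inv_le_log_of_pos h0) h0.le
  rw [mul_sub, mul_one, mul_inv_cancel₀ h0.ne'] at h2
  have h3 := mul_nonpos_of_nonneg_of_nonpos h0.le (Real.log_nonpos h0.le h1)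
  rw [Real.norm_eq_abs, abs_le]
  constructor <;> linarith

lemma continuousOn_freeEnergy [BorelSpace E] [ProperSpace E] [IsFiniteMeasure μ]
    (hμ : Integrable (fun y => ‖y‖) μ) :
    ContinuousOn (fun w : C(E, ℝ) => freeEnergy μ w) (admissibleDensities μ) := by
  have heval (x : E) : Continuous fun w : C(E, ℝ) => w x :=
    ContinuousEvalConst.continuous_eval_const x
  have hP (x : E) : ContinuousOn (fun w : C(E, ℝ) => normPotential μ w x)
      (admissibleDensities μ) := by
    refine continuousOn_of_dominated (bound := fun y => ‖x‖ + ‖y‖)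
      (fun w _ => by fun_prop) (fun w hw => .of_forall fun y => ?_)
      ((integrable_const _).add hμ) (.of_forall fun y => ?_)
    · rw [norm_mul, norm_norm, Real.norm_eq_abs]
      calc ‖x - y‖ * |w y| ≤ ‖x - y‖ * 1 := by
            gcongr
            exact admissibleDensities_abs_le_one hw y
        _ ≤ ‖x‖ + ‖y‖ := by rw [mul_one]; exact norm_sub_le x y
    · exact (continuous_const.mul (heval y)).continuousOn
  refine ContinuousOn.add ?_ (continuousOn_const.mul ?_)
  · refine continuousOn_of_dominated (bound := fun _ => 1) (fun w _ => ?_)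
      (fun w hw => .of_forall fun x => ?_) (integrable_const _) (.of_forall fun x => ?_)
    · exact ((Real.continuous_mul_log.comp w.continuous).sub w.continuous).aestronglyMeasurable
    · exact norm_mul_log_sub_self_le (admissibleDensities_pos hw x) (hw x x).2.1
    · exact ((Real.continuous_mul_log.comp (heval x)).sub (heval x)).continuousOn
  · refine continuousOn_of_dominated (bound := fun x => normPotentialBound μ * (1 + ‖x‖))
      (fun w hw => ?_) (fun w hw => .of_forall fun x => ?_)
      (((integrable_const _).add hμ).const_mul _) (.of_forall fun x => ?_)
    · exact (w.continuous.mul (continuous_normPotential hμ w.continuous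
        (admissibleDensities_abs_le_one hw))).aestronglyMeasurable
    · rw [norm_mul, Real.norm_eq_abs, Real.norm_eq_abs]
      have h1 := admissibleDensities_abs_le_one hw
      calc |w x| * |normPotential μ w x| ≤ 1 * (normPotentialBound μ * (1 + ‖x‖)) := by
            gcongr
            · exact h1 x
            · exact abs_normPotential_le hμ h1 x
        _ = _ := one_mul _
    · exact (heval x).continuousOn.mul (hP x)

lemma one_mem_admissibleDensities : (1 : C(E, ℝ)) ∈ admissibleDensities μ := by
  have hA0 : 0 ≤ normPotentialBound μ := normPotentialBound_nonneg
  intro x y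
  refine ⟨Real.exp_le_one_iff.2 ?_, le_rfl, ?_, fun _ => rfl⟩
  · simp only [Left.neg_nonpos_iff]
    positivity
  · simp only [ContinuousMap.one_apply, sub_self, abs_zero]
    positivity

lemma convex_admissibleDensities {v w b : C(E, ℝ)} (hv : v ∈ admissibleDensities μ)
    (hw : w ∈ admissibleDensities μ) {t : ℝ} (ht0 : 0 ≤ t) (ht1 : t ≤ 1)
    (hb : ∀ x, b x = w x + t * (v x - w x)) : b ∈ admissibleDensities μ := by
  intro x y
  obtain ⟨v1, v2, v3, v4⟩ := hv x y
  obtain ⟨w1, w2, w3, w4⟩ := hw x y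
  have hs : 0 ≤ 1 - t := by linarith
  rw [hb x, hb y]
  refine ⟨by nlinarith, by nlinarith, ?_, fun h => by rw [v4 h, w4 h]⟩
  rw [abs_le] at v3 w3 ⊢
  constructor <;> nlinarith

lemma abs_exp_neg_sub_exp_neg_le {a b : ℝ} (ha : 0 ≤ a) (hb : 0 ≤ b) :
    |Real.exp (-a) - Real.exp (-b)| ≤ |a - b| := by
  wlog hab : a ≤ b generalizing a b
  · rw [abs_sub_comm, abs_sub_comm a b]
    exact this hb ha (le_of_not_ge hab)
  have h1 : Real.exp (-b) ≤ Real.exp (-a) := Real.exp_le_exp.2 (by linarith)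
  rw [abs_of_nonneg (by linarith), abs_of_nonpos (by linarith)]
  have h2 : Real.exp (-b) = Real.exp (-a) * Real.exp (a - b) := by rw [← Real.exp_add]; ring_nf
  have h3 := Real.add_one_le_exp (a - b)
  have h4 : Real.exp (-a) ≤ 1 := Real.exp_le_one_iff.2 (by linarith)
  nlinarith [Real.exp_pos (-a)]

end Admissible

section EulerLagrange

variable {E : Type*} [NormedAddCommGroup E] [InnerProductSpace ℝ E] [MeasurableSpace E]
  {μ : Measure E}

lemma normPotential_eq_of_norm_eq
    (hrot : ∀ (ρ : E ≃ₗᵢ[ℝ] E) (f : E → ℝ), ∫ y, f (ρ y) ∂μ = ∫ y, f y ∂μ)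
    {w : E → ℝ} (hw : ∀ x y, ‖x‖ = ‖y‖ → w x = w y) {x y : E} (hxy : ‖x‖ = ‖y‖) :
    normPotential μ w x = normPotential μ w y := by
  set ρ : E ≃ₗᵢ[ℝ] E := (Submodule.span ℝ {x - y})ᗮ.reflection
  have hρ : ρ x = y := Submodule.reflection_sub hxy
  unfold normPotential
  rw [← hrot ρ fun z => ‖y - z‖ * w z]
  congr! 2 with z
  rw [← hρ, ← map_sub, ρ.norm_map, hw (ρ z) z (ρ.norm_map z)]

variable [BorelSpace E]

lemma exp_neg_normPotential_mem [SecondCountableTopology E] [IsFiniteMeasure μ]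
    (hμ : Integrable (fun y => ‖y‖) μ)
    (hrot : ∀ (ρ : E ≃ₗᵢ[ℝ] E) (f : E → ℝ), ∫ y, f (ρ y) ∂μ = ∫ y, f y ∂μ)
    {v w : C(E, ℝ)} (hw : w ∈ admissibleDensities μ)
    (hv : ∀ x, v x = Real.exp (-normPotential μ w x)) : v ∈ admissibleDensities μ := by
  have h1 := admissibleDensities_abs_le_one hw
  have hP (x : E) : 0 ≤ normPotential μ w x := integral_nonneg fun y =>
    mul_nonneg (norm_nonneg _) (admissibleDensities_pos hw y).le
  intro x y
  rw [hv x, hv y]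
  refine ⟨?_, ?_, ?_, fun h => ?_⟩
  · exact Real.exp_le_exp.2 (neg_le_neg ((le_abs_self _).trans (abs_normPotential_le hμ h1 x)))
  · exact Real.exp_le_one_iff.2 (neg_nonpos.2 (hP x))
  · exact (abs_exp_neg_sub_exp_neg_le (hP x) (hP y)).trans
      (abs_normPotential_sub_le hμ w.continuous h1 x y)
  · rw [normPotential_eq_of_norm_eq hrot (fun a b => (hw a b).2.2.2) h]

lemma mul_log_sub_self_sub_le {a b : ℝ} (ha : 0 < a) (hb : 0 < b) :
    (b * Real.log b - b) - (a * Real.log a - a) ≤ (b - a) * Real.log a + (b - a) ^ 2 / a := by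
  have h := mul_le_mul_of_nonneg_left (Real.log_le_sub_one_of_pos (div_pos hb ha)) hb.le
  rw [Real.log_div hb.ne' ha.ne'] at h
  have h2 : (b - a) ^ 2 / a = b * (b / a - 1) - (b - a) := by
    field_simp
  rw [h2]
  linarith

lemma exp_sub_exp_mul_sub_nonneg (l p : ℝ) : 0 ≤ (Real.exp p - Real.exp l) * (p - l) := by
  rcases le_total l p with h | h
  · exact mul_nonneg (sub_nonneg.2 (Real.exp_le_exp.2 h)) (sub_nonneg.2 h)
  · exact mul_nonneg_of_nonpos_of_nonpos (sub_nonpos.2 (Real.exp_le_exp.2 h)) (sub_nonpos.2 h)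

lemma nonneg_of_forall_add_mul_nonneg {D M : ℝ} (h : ∀ t, 0 < t → t ≤ 1 → 0 ≤ t * D + t ^ 2 * M) :
    0 ≤ D := by
  by_contra! hD
  have hM : 0 < 1 + |M| := by positivity
  set t := min 1 (-D / (2 * (1 + |M|)))
  have ht : 0 < t := lt_min one_pos (by apply div_pos <;> linarith)
  have h1 := h t ht (min_le_left _ _)
  have h2 : t * (2 * (1 + |M|)) ≤ -D := (le_div_iff₀ (by positivity)).1 (min_le_right _ _)
  have h3 : 0 ≤ D + t * M := by
    by_contra! h4
    nlinarith
  nlinarith [le_abs_self M]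

lemma ae_eq_exp_neg_normPotential_of_isMinOn [SecondCountableTopology E] [IsFiniteMeasure μ]
    (hμ : ∀ c : ℝ, Integrable (fun y => Real.exp (c * ‖y‖)) μ)
    (hμ1 : Integrable (fun y => ‖y‖) μ)
    (hrot : ∀ (ρ : E ≃ₗᵢ[ℝ] E) (f : E → ℝ), ∫ y, f (ρ y) ∂μ = ∫ y, f y ∂μ)
    {w : C(E, ℝ)} (hw : w ∈ admissibleDensities μ)
    (hmin : IsMinOn (fun w : C(E, ℝ) => freeEnergy μ w) (admissibleDensities μ) w) :
    ∀ᵐ x ∂μ, w x = Real.exp (-normPotential μ w x) := by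
  set A := normPotentialBound μ with hA
  have hw0 := admissibleDensities_pos hw
  have hw1 := admissibleDensities_abs_le_one hw
  have hPc : Continuous (normPotential μ w) := continuous_normPotential hμ1 w.continuous hw1
  obtain ⟨v, hv⟩ : ∃ v : C(E, ℝ), ∀ x, v x = Real.exp (-normPotential μ w x) :=
    ⟨⟨_, Real.continuous_exp.comp hPc.neg⟩, fun _ => rfl⟩
  have hvmem := exp_neg_normPotential_mem hμ1 hrot hw hv
  set h : E → ℝ := fun x => v x - w x with hh
  have hhc : Continuous h := v.continuous.sub w.continuous
  have hh1 (x : E) : |h x| ≤ 1 := by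
    have := admissibleDensities_pos hvmem x
    have := (hvmem x x).2.1
    have := hw0 x
    have := (hw x x).2.1
    rw [abs_le]
    constructor <;> simp only [hh] <;> linarith
  have hlogc : Continuous fun x => Real.log (w x) := w.continuous.log fun x => (hw0 x).ne'
  have hlog (x : E) : |Real.log (w x)| ≤ A * (1 + ‖x‖) := by
    rw [abs_of_nonpos (Real.log_nonpos (hw0 x).le (hw x x).2.1), neg_le]
    exact (Real.le_log_iff_exp_le (hw0 x)).2 (hw x x).1
  have hi_log : Integrable (fun x => h x * Real.log (w x)) μ := by
    refine (((integrable_const (1 : ℝ)).add hμ1).const_mul A).mono'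
      (hhc.mul hlogc).aestronglyMeasurable (.of_forall fun x => ?_)
    rw [norm_mul, Real.norm_eq_abs, Real.norm_eq_abs]
    calc |h x| * |Real.log (w x)| ≤ 1 * (A * (1 + ‖x‖)) := by
          gcongr
          · exact hh1 x
          · exact hlog x
      _ = _ := by simp
  have hi_sq : Integrable (fun x => h x ^ 2 / w x) μ := by
    refine ((hμ A).const_mul (Real.exp A)).mono'
      ((hhc.pow 2).div w.continuous fun x => (hw0 x).ne').aestronglyMeasurable
      (.of_forall fun x => ?_)
    rw [Real.norm_eq_abs, abs_of_nonneg (div_nonneg (sq_nonneg _) (hw0 x).le), ← Real.exp_add,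
      div_le_iff₀ (hw0 x)]
    have h1 : h x ^ 2 ≤ 1 := (sq_le_one_iff_abs_le_one _).2 (hh1 x)
    have h2 := mul_le_mul_of_nonneg_left (hw x x).1 (Real.exp_pos (A + A * ‖x‖)).le
    rw [← Real.exp_add, ← hA, show A + A * ‖x‖ + -(A * (1 + ‖x‖)) = 0 by ring, Real.exp_zero] at h2
    exact h1.trans h2
  have hi_ent {b : C(E, ℝ)} (hb : b ∈ admissibleDensities μ) :
      Integrable (fun x => b x * Real.log (b x) - b x) μ := by
    refine (integrable_const (1 : ℝ)).mono'
      ((Real.continuous_mul_log.comp b.continuous).sub b.continuous).aestronglyMeasurable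
      (.of_forall fun x => ?_)
    exact norm_mul_log_sub_self_le (admissibleDensities_pos hb x) (hb x x).2.1
  have hi_P := integrable_mul_normPotential hμ1 hhc hh1 w.continuous hw1
  have hD : 0 ≤ ∫ x, h x * Real.log (w x) ∂μ + ∫ x, h x * normPotential μ w x ∂μ := by
    refine nonneg_of_forall_add_mul_nonneg
      (M := ∫ x, h x ^ 2 / w x ∂μ + 1 / 2 * ∫ x, h x * normPotential μ h x ∂μ) fun t ht0 ht1 => ?_
    obtain ⟨b, hb⟩ : ∃ b : C(E, ℝ), ∀ x, b x = w x + t * h x :=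
      ⟨⟨fun x => w x + t * h x, by fun_prop⟩, fun _ => rfl⟩
    have hbmem := convex_admissibleDensities hvmem hw ht0.le ht1 hb
    have hJ : freeEnergy μ w ≤ freeEnergy μ b := hmin hbmem
    have hbfun : (b : E → ℝ) = fun x => w x + t * h x := funext hb
    have hquad := integral_add_mul_normPotential hμ1 w.continuous hw1 hhc hh1 t
    have hent : ∫ x, (b x * Real.log (b x) - b x) ∂μ - ∫ x, (w x * Real.log (w x) - w x) ∂μ
        ≤ t * ∫ x, h x * Real.log (w x) ∂μ + t ^ 2 * ∫ x, h x ^ 2 / w x ∂μ := by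
      rw [← integral_sub (hi_ent hbmem) (hi_ent hw), ← integral_const_mul, ← integral_const_mul,
        ← integral_add (hi_log.const_mul _) (hi_sq.const_mul _)]
      refine integral_mono ((hi_ent hbmem).sub (hi_ent hw))
        ((hi_log.const_mul _).add (hi_sq.const_mul _)) fun x => ?_
      have := mul_log_sub_self_sub_le (hw0 x) (admissibleDensities_pos hbmem x)
      refine this.trans_eq ?_
      rw [hb x]
      ring
    rw [← hbfun] at hquad
    unfold freeEnergy at hJ
    have hquad' : ∫ x, b x * normPotential μ b x ∂μ = _ :=
      (integral_congr_ae (.of_forall fun x => by simp only [hb x])).trans hquad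
    rw [hquad'] at hJ
    linarith
  have hG0 : 0 ≤ fun x => -(h x * Real.log (w x) + h x * normPotential μ w x) := fun x => by
    have := exp_sub_exp_mul_sub_nonneg (Real.log (w x)) (-normPotential μ w x)
    rw [Real.exp_log (hw0 x), ← hv x] at this
    exact this.trans_eq (by simp only [hh]; ring)
  have hGint : Integrable (fun x => -(h x * Real.log (w x) + h x * normPotential μ w x)) μ :=
    (hi_log.add hi_P).neg
  have hG : ∫ x, -(h x * Real.log (w x) + h x * normPotential μ w x) ∂μ = 0 := by
    refine le_antisymm ?_ (integral_nonneg hG0)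
    rw [integral_neg, integral_add hi_log hi_P]
    linarith
  filter_upwards [(integral_eq_zero_iff_of_nonneg hG0 hGint).1 hG] with x hx
  have hx' : h x * (Real.log (w x) + normPotential μ w x) = 0 := by
    simp only [Pi.zero_apply] at hx
    linarith
  rcases mul_eq_zero.1 hx' with h0 | h0
  · rw [← hv x]
    simp only [hh] at h0
    linarith
  · rw [← eq_neg_of_add_eq_zero_left h0, Real.exp_log (hw0 x)]

end EulerLagrange

section Existence

variable {E : Type*} [NormedAddCommGroup E] [InnerProductSpace ℝ E] [ProperSpace E]
  [MeasurableSpace E] [BorelSpace E]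

/-- For a rotation invariant measure with all exponential moments, the nonlinear integral equation
`u(x) = -∫ ‖x - y‖ e^{u(y)} dμ(y)` has a continuous radial solution of linear growth: it is obtained
from a minimizer of the free energy over the admissible densities. -/
theorem exists_eq_neg_integral_norm_sub_mul_exp (μ : Measure E)
    (hμ : ∀ c : ℝ, Integrable (fun y => Real.exp (c * ‖y‖)) μ)
    (hrot : ∀ (ρ : E ≃ₗᵢ[ℝ] E) (f : E → ℝ), ∫ y, f (ρ y) ∂μ = ∫ y, f y ∂μ) :
    ∃ u : E → ℝ, Continuous u ∧ (∀ x y, ‖x‖ = ‖y‖ → u x = u y) ∧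
      (∃ C : ℝ, ∀ x, |u x| ≤ C * (1 + ‖x‖)) ∧
      (∀ x, Integrable (fun y => ‖x - y‖ * Real.exp (u y)) μ) ∧
      ∀ x, u x = -∫ y, ‖x - y‖ * Real.exp (u y) ∂μ := by
  have hfin : IsFiniteMeasure μ := by
    have := hμ 0
    simp only [zero_mul, Real.exp_zero] at this
    exact (integrable_const_iff_isFiniteMeasure one_ne_zero).1 this
  have hμ1 : Integrable (fun y => ‖y‖) μ := by
    refine (hμ 1).mono' (by fun_prop) (.of_forall fun y => ?_)
    rw [norm_norm, one_mul]
    linarith [Real.add_one_le_exp ‖y‖]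
  obtain ⟨w, hw, hmin⟩ := isCompact_admissibleDensities.exists_isMinOn
    ⟨_, one_mem_admissibleDensities⟩ (continuousOn_freeEnergy hμ1)
  have hae := ae_eq_exp_neg_normPotential_of_isMinOn hμ hμ1 hrot hw hmin
  have hw1 := admissibleDensities_abs_le_one hw
  have hcongr (x : E) : (fun y => ‖x - y‖ * w y) =ᵐ[μ]
      fun y => ‖x - y‖ * Real.exp (-normPotential μ w y) := by
    filter_upwards [hae] with y hy
    rw [← hy]
  refine ⟨fun x => -normPotential μ w x, (continuous_normPotential hμ1 w.continuous hw1).neg,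
    fun x y hxy => ?_, ⟨normPotentialBound μ, fun x => ?_⟩, fun x => ?_, fun x => ?_⟩
  · exact congrArg Neg.neg (normPotential_eq_of_norm_eq hrot (fun a b => (hw a b).2.2.2) hxy)
  · rw [abs_neg]
    exact abs_normPotential_le hμ1 hw1 x
  · exact (integrable_norm_sub_mul hμ1 w.continuous hw1 x).congr (hcongr x)
  · exact congrArg Neg.neg (integral_congr_ae (hcongr x))

end Existence

lemma integrable_exp_neg_mul_sq_norm_mul_exp {E : Type*} [NormedAddCommGroup E]
    [InnerProductSpace ℝ E] [FiniteDimensional ℝ E] [MeasurableSpace E] [BorelSpace E]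
    {ε : ℝ} (hε : 0 < ε) (c : ℝ) :
    Integrable (fun y : E => Real.exp (-ε * ‖y‖ ^ 2) * Real.exp (c * ‖y‖)) := by
  have hgauss : Integrable (fun y : E => Real.exp (-(ε / 2) * ‖y‖ ^ 2)) := by
    have h := (GaussianFourier.integrable_cexp_neg_mul_sq_norm_add (V := E)
      (b := ((ε / 2 : ℝ) : ℂ)) (by simpa using hε) 0 0).norm
    refine h.congr (.of_forall fun y => ?_)
    simp [Complex.norm_exp, ← Complex.ofReal_pow]
  refine (hgauss.const_mul (Real.exp (c ^ 2 / (2 * ε)))).mono' (by fun_prop)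
    (.of_forall fun y => ?_)
  rw [Real.norm_eq_abs, abs_of_nonneg (by positivity), ← Real.exp_add, ← Real.exp_add,
    Real.exp_le_exp]
  have h : c ^ 2 / (2 * ε) + -(ε / 2) * ‖y‖ ^ 2 - (-ε * ‖y‖ ^ 2 + c * ‖y‖)
      = (c - ε * ‖y‖) ^ 2 / (2 * ε) := by
    field_simp
    ring
  have h' : 0 ≤ (c - ε * ‖y‖) ^ 2 / (2 * ε) := by positivity
  linarith


/-- For every `ε > 0` there is a continuous radial function `u : ℝ³ → ℝ` with
`sup_x |u(x)|/(1+|x|) < ∞` solving the Gaussian-regularized integral form of the 3D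
fourth-order Liouville equation:
`u(x) = −(1/(8π)) ∫_{ℝ³} |x−y| e^{−ε|y|²} e^{u(y)} dy`, the integral being convergent. -/
theorem stmt9 (ε : ℝ) (hε : 0 < ε) :
    ∃ u : EuclideanSpace ℝ (Fin 3) → ℝ, Continuous u ∧
      (∀ x y : EuclideanSpace ℝ (Fin 3), ‖x‖ = ‖y‖ → u x = u y) ∧
      (∃ C : ℝ, ∀ x : EuclideanSpace ℝ (Fin 3), |u x| ≤ C * (1 + ‖x‖)) ∧
      (∀ x : EuclideanSpace ℝ (Fin 3),
        Integrable (fun y : EuclideanSpace ℝ (Fin 3) =>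
          ‖x - y‖ * Real.exp (-ε * ‖y‖ ^ 2) * Real.exp (u y))) ∧
      (∀ x : EuclideanSpace ℝ (Fin 3),
        u x = -(1 / (8 * Real.pi)) *
          ∫ y : EuclideanSpace ℝ (Fin 3),
            ‖x - y‖ * Real.exp (-ε * ‖y‖ ^ 2) * Real.exp (u y)) := by
  have hk : (0 : ℝ) < 1 / (8 * Real.pi) := by positivity
  set k : ℝ := 1 / (8 * Real.pi)
  set d : EuclideanSpace ℝ (Fin 3) → ENNReal :=
    fun y => ENNReal.ofReal (k * Real.exp (-ε * ‖y‖ ^ 2))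
  have hdm : Measurable d := by fun_prop
  have hdfin : ∀ᵐ y ∂(volume : Measure (EuclideanSpace ℝ (Fin 3))), d y < ⊤ :=
    .of_forall fun y => ENNReal.ofReal_lt_top
  have hdr (y : EuclideanSpace ℝ (Fin 3)) : (d y).toReal = k * Real.exp (-ε * ‖y‖ ^ 2) :=
    ENNReal.toReal_ofReal (by positivity)
  obtain ⟨u, hc, hrad, hgrowth, hint, heq⟩ :=
    exists_eq_neg_integral_norm_sub_mul_exp (volume.withDensity d) (fun c => by
      rw [integrable_withDensity_iff_integrable_smul' hdm hdfin]
      simp only [hdr, smul_eq_mul, mul_assoc]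
      exact (integrable_exp_neg_mul_sq_norm_mul_exp hε c).const_mul k) (fun ρ f => by
      rw [integral_withDensity_eq_integral_toReal_smul hdm hdfin,
        integral_withDensity_eq_integral_toReal_smul hdm hdfin,
        ← ρ.measurePreserving.integral_comp ρ.toHomeomorph.measurableEmbedding
          (fun y => (d y).toReal • f y)]
      simp only [hdr, ρ.norm_map])
  refine ⟨u, hc, hrad, hgrowth, fun x => ?_, fun x => ?_⟩
  · have h := hint x
    rw [integrable_withDensity_iff_integrable_smul' hdm hdfin] at h
    refine (h.const_mul k⁻¹).congr (.of_forall fun y => ?_)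
    simp only [hdr, smul_eq_mul]
    field_simp
  · rw [heq x, integral_withDensity_eq_integral_toReal_smul hdm hdfin, neg_mul,
      ← integral_const_mul]
    congr! 3 with y
    rw [hdr, smul_eq_mul]
    ring
end

section
/- There exists a continuous function u : ℝ³ → ℝ such that: (i) u is radial, i.e. u(x) depends only on the Euclidean norm |x|; (ii) there is C > 0 with |u(x)| ≤ C(1+|x|) for all x; (iii) there is δ > 0 with u(x) ≤ δ(1−|x|) for all x; (iv) for every x ∈ ℝ³ the integral ∫_{ℝ³} |x−y| e^{u(y)} dy converges and u(x) = −(1/(8π)) ∫_{ℝ³} |x−y| e^{u(y)} dy; and consequently (v) u has finite volume: ∫_{ℝ³} e^{u(x)} dx < +∞. -/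
open MeasureTheory
open Set Filter Topology

/-- The average of `‖x - y‖` over the sphere `‖y‖ = s` in `ℝ³`, where `‖x‖ = r`. -/
noncomputable def shellKernel (r s : ℝ) : ℝ := max r s + min r s ^ 2 / (3 * max r s)

lemma shellKernel_of_le {r s : ℝ} (h : s ≤ r) : shellKernel r s = r + s ^ 2 / (3 * r) := by
  simp [shellKernel, h]

lemma shellKernel_of_ge {r s : ℝ} (h : r ≤ s) : shellKernel r s = s + r ^ 2 / (3 * s) := by
  simp [shellKernel, h]

lemma shellKernel_zero_left {s : ℝ} (hs : 0 < s) : shellKernel 0 s = s := by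
  rw [shellKernel_of_ge hs.le]; simp

lemma shellKernel_le_add_sub {r₁ r₂ s : ℝ} (h : r₁ ≤ r₂) (hs : 0 < s) :
    shellKernel r₂ s ≤ shellKernel r₁ s + (r₂ - r₁) := by
  rcases le_total r₁ s with h1 | h1 <;> rcases le_total r₂ s with h2 | h2
  · rw [shellKernel_of_ge h1, shellKernel_of_ge h2]
    have : r₂ ^ 2 / (3 * s) - r₁ ^ 2 / (3 * s) ≤ r₂ - r₁ := by
      rw [← sub_div, div_le_iff₀ (by positivity)]; nlinarith
    linarith
  · have hr : 0 < r₂ := hs.trans_le h2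
    rw [shellKernel_of_ge h1, shellKernel_of_le h2]
    have e1 : s ^ 2 / (3 * r₂) ≤ s / 3 := by
      rw [div_le_div_iff₀ (by positivity) (by positivity)]; nlinarith
    have e2 : s / 3 - r₁ ^ 2 / (3 * s) ≤ s - r₁ := by
      have : s / 3 - r₁ ^ 2 / (3 * s) = (s ^ 2 - r₁ ^ 2) / (3 * s) := by field_simp
      rw [this, div_le_iff₀ (by positivity)]; nlinarith
    linarith
  · have : r₁ = r₂ := by linarith
    subst this; simp
  · have hr : 0 < r₁ := hs.trans_le h1
    rw [shellKernel_of_le h1, shellKernel_of_le h2]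
    have : s ^ 2 / (3 * r₂) ≤ s ^ 2 / (3 * r₁) := by gcongr
    linarith

lemma two_thirds_mul_le_shellKernel_sub {r₁ r₂ s : ℝ} (h : r₁ ≤ r₂) (hs : 0 < s) (h1 : s ≤ r₁) :
    2 / 3 * (r₂ - r₁) ≤ shellKernel r₂ s - shellKernel r₁ s := by
  have hr : 0 < r₁ := hs.trans_le h1
  have hr2 : 0 < r₂ := hr.trans_le h
  rw [shellKernel_of_le h1, shellKernel_of_le (h1.trans h)]
  have : s ^ 2 / (3 * r₁) - s ^ 2 / (3 * r₂) ≤ (r₂ - r₁) / 3 := by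
    have e : s ^ 2 / (3 * r₁) - s ^ 2 / (3 * r₂) = s ^ 2 * (r₂ - r₁) / (3 * (r₁ * r₂)) := by
      field_simp
    rw [e, div_le_div_iff₀ (by positivity) (by positivity)]
    have : s ^ 2 ≤ r₁ * r₂ := by nlinarith
    nlinarith [mul_le_mul_of_nonneg_right this (sub_nonneg.2 h)]
  linarith

lemma shellKernel_mono {r₁ r₂ s : ℝ} (h₁ : 0 ≤ r₁) (h : r₁ ≤ r₂) (hs : 0 < s) :
    shellKernel r₁ s ≤ shellKernel r₂ s := by
  have key : ∀ {r₁ r₂ : ℝ}, 0 ≤ r₁ → r₁ ≤ r₂ → r₂ ≤ s → shellKernel r₁ s ≤ shellKernel r₂ s := by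
    intro r₁ r₂ h₁ h h2
    rw [shellKernel_of_ge h2, shellKernel_of_ge (h.trans h2)]
    gcongr
  have key2 : ∀ {r₁ r₂ : ℝ}, r₁ ≤ r₂ → s ≤ r₁ → shellKernel r₁ s ≤ shellKernel r₂ s := by
    intro r₁ r₂ h h1
    linarith [two_thirds_mul_le_shellKernel_sub h hs h1]
  rcases le_total r₂ s with h2 | h2
  · exact key h₁ h h2
  rcases le_total r₁ s with h1 | h1
  · exact (key h₁ h1 le_rfl).trans (key2 h2 le_rfl)
  · exact key2 h h1

lemma shellKernel_sub_antitoneOn {r₁ r₂ : ℝ} (h₁ : 0 ≤ r₁) (h : r₁ ≤ r₂) :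
    AntitoneOn (fun s => shellKernel r₂ s - shellKernel r₁ s) (Ioi 0) := by
  have step : ∀ {s t : ℝ}, 0 < s → s ≤ t → (t ≤ r₁ ∨ (r₁ ≤ s ∧ t ≤ r₂) ∨ r₂ ≤ s) →
      shellKernel r₂ t - shellKernel r₁ t ≤ shellKernel r₂ s - shellKernel r₁ s := by
    intro s t hs hst hc
    have ht : 0 < t := hs.trans_le hst
    rcases hc with hc | ⟨hc1, hc2⟩ | hc
    · have hr1 : 0 < r₁ := ht.trans_le hc
      have hr2 : 0 < r₂ := hr1.trans_le h
      rw [shellKernel_of_le hc, shellKernel_of_le (hc.trans h), shellKernel_of_le (hst.trans hc),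
        shellKernel_of_le (hst.trans (hc.trans h))]
      have e : ∀ x : ℝ,
          x ^ 2 / (3 * r₁) - x ^ 2 / (3 * r₂) = x ^ 2 * ((r₂ - r₁) / (3 * (r₁ * r₂))) := by
        intro x; field_simp
      have : s ^ 2 * ((r₂ - r₁) / (3 * (r₁ * r₂))) ≤ t ^ 2 * ((r₂ - r₁) / (3 * (r₁ * r₂))) := by
        have := sub_nonneg.2 h
        gcongr
      linarith [e s, e t]
    · have hr2 : 0 < r₂ := ht.trans_le hc2
      rw [shellKernel_of_le hc2, shellKernel_of_le (hst.trans hc2), shellKernel_of_ge hc1,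
        shellKernel_of_ge (hc1.trans hst)]
      have e1 : t ^ 2 / (3 * r₂) - s ^ 2 / (3 * r₂) ≤ 2 / 3 * (t - s) := by
        rw [← sub_div, div_le_iff₀ (by positivity)]; nlinarith
      have e2 : r₁ ^ 2 / (3 * s) - r₁ ^ 2 / (3 * t) ≤ (t - s) / 3 := by
        have e : r₁ ^ 2 / (3 * s) - r₁ ^ 2 / (3 * t) = r₁ ^ 2 * (t - s) / (3 * (s * t)) := by
          field_simp
        rw [e, div_le_div_iff₀ (by positivity) (by positivity)]
        have : r₁ ^ 2 ≤ s * t := by nlinarith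
        nlinarith [mul_le_mul_of_nonneg_right this (sub_nonneg.2 hst)]
      linarith
    · rw [shellKernel_of_ge hc, shellKernel_of_ge (hc.trans hst), shellKernel_of_ge (h.trans hc),
        shellKernel_of_ge ((h.trans hc).trans hst)]
      have : (r₂ ^ 2 - r₁ ^ 2) / (3 * t) ≤ (r₂ ^ 2 - r₁ ^ 2) / (3 * s) := by
        have : 0 ≤ r₂ ^ 2 - r₁ ^ 2 := by nlinarith
        gcongr
      rw [sub_div, sub_div] at this
      linarith
  have step2 : ∀ {s t : ℝ}, 0 < s → s ≤ t → (t ≤ r₂ ∨ r₂ ≤ s) →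
      shellKernel r₂ t - shellKernel r₁ t ≤ shellKernel r₂ s - shellKernel r₁ s := by
    intro s t hs hst hc
    rcases hc with hc | hc
    · rcases le_total t r₁ with h1 | h1
      · exact step hs hst (.inl h1)
      rcases le_total r₁ s with h2 | h2
      · exact step hs hst (.inr (.inl ⟨h2, hc⟩))
      · exact (step (hs.trans_le h2) h1 (.inr (.inl ⟨le_rfl, hc⟩))).trans
          (step hs h2 (.inl le_rfl))
    · exact step hs hst (.inr (.inr hc))
  intro s hs t _ hst
  rcases le_total t r₂ with h1 | h1
  · exact step2 hs hst (.inl h1)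
  rcases le_total r₂ s with h2 | h2
  · exact step2 hs hst (.inr h2)
  · exact (step2 (lt_of_lt_of_le hs h2) h1 (.inr le_rfl)).trans (step2 hs h2 (.inl le_rfl))

lemma le_shellKernel {r s : ℝ} (hr : 0 ≤ r) (hs : 0 < s) : s ≤ shellKernel r s := by
  simpa [shellKernel_zero_left hs] using shellKernel_mono le_rfl hr hs

lemma shellKernel_le_add {r s : ℝ} (hr : 0 ≤ r) (hs : 0 < s) : shellKernel r s ≤ s + r := by
  simpa [shellKernel_zero_left hs] using shellKernel_le_add_sub hr hs

lemma measurable_shellKernel (r : ℝ) : Measurable (shellKernel r) := by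
  unfold shellKernel; fun_prop

/-- Chebyshev's integral inequality, for a function `h` that tends to be large where the ratio
`q / p` of the two weights is. -/
lemma integral_mul_integral_le_of_covary {α : Type*} [MeasurableSpace α] {μ : Measure α}
    {S : Set α} (hS : MeasurableSet S) {p q h : α → ℝ} (hp : IntegrableOn p S μ)
    (hq : IntegrableOn q S μ) (hhp : IntegrableOn (fun s => h s * p s) S μ)
    (hhq : IntegrableOn (fun s => h s * q s) S μ)
    (hpq : ∀ s ∈ S, ∀ t ∈ S, 0 ≤ (h s - h t) * (q s * p t - q t * p s)) :
    (∫ s in S, h s * p s ∂μ) * (∫ s in S, q s ∂μ) ≤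
      (∫ s in S, h s * q s ∂μ) * ∫ s in S, p s ∂μ := by
  set P := ∫ s in S, p s ∂μ
  set Q := ∫ s in S, q s ∂μ
  set HP := ∫ s in S, h s * p s ∂μ
  set HQ := ∫ s in S, h s * q s ∂μ
  have h1 : ∀ t ∈ S, 0 ≤ HQ * p t - HP * q t - Q * (h t * p t) + P * (h t * q t) := by
    intro t ht
    have : ∫ s in S, (h s * q s) * p t - (h s * p s) * q t - q s * (h t * p t)
        + p s * (h t * q t) ∂μ
        = HQ * p t - HP * q t - Q * (h t * p t) + P * (h t * q t) := by
      rw [integral_add, integral_sub, integral_sub]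
      · simp only [integral_mul_const]; rfl
      · exact hhq.mul_const _
      · exact hhp.mul_const _
      · exact (hhq.mul_const _).sub (hhp.mul_const _)
      · exact hq.mul_const _
      · exact ((hhq.mul_const _).sub (hhp.mul_const _)).sub (hq.mul_const _)
      · exact hp.mul_const _
    rw [← this]
    refine setIntegral_nonneg hS fun s hs => ?_
    linarith [hpq s hs t ht]
  have h2 : ∫ t in S, HQ * p t - HP * q t - Q * (h t * p t) + P * (h t * q t) ∂μ
      = HQ * P - HP * Q - Q * HP + P * HQ := by
    rw [integral_add, integral_sub, integral_sub]
    · simp only [integral_const_mul]; rfl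
    · exact hp.const_mul _
    · exact hq.const_mul _
    · exact (hp.const_mul _).sub (hq.const_mul _)
    · exact hhp.const_mul _
    · exact ((hp.const_mul _).sub (hq.const_mul _)).sub (hhp.const_mul _)
    · exact hhq.const_mul _
  have h3 := setIntegral_nonneg (μ := μ) hS h1
  linarith

/-- The weight of a radial density `e^{-G(|y|)}` on `ℝ³`, up to the factor `4π`. -/
noncomputable def radialWeight (G : ℝ → ℝ) (s : ℝ) : ℝ := s ^ 2 * Real.exp (-G s)

/-- The total mass of the radial density `e^{-G(|y|)}` on `ℝ³`, up to the factor `4π`. -/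
noncomputable def radialMass (G : ℝ → ℝ) : ℝ := ∫ s in Ioi 0, radialWeight G s

/-- The potential, normalised at the origin, generated by the probability measure on `ℝ³` with
density proportional to `e^{-G(|y|)}`. -/
noncomputable def potentialMap (G : ℝ → ℝ) (r : ℝ) : ℝ :=
  (∫ s in Ioi 0, (shellKernel r s - s) * radialWeight G s) / radialMass G

/-- A subsolution of the fixed point problem for `potentialMap`. -/
noncomputable def barrier (r : ℝ) : ℝ := max (r - 18) 0 / 3

/-- Profiles growing at least as fast as the barrier. -/
structure IsAdmissible (G : ℝ → ℝ) : Prop where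
  zero : G 0 = 0
  sub_barrier : MonotoneOn (fun r => G r - barrier r) (Ici 0)

lemma barrier_zero : barrier 0 = 0 := by norm_num [barrier]

lemma barrier_mono : Monotone barrier := by
  intro a b h; unfold barrier; gcongr

lemma barrier_nonneg (r : ℝ) : 0 ≤ barrier r := by unfold barrier; positivity

lemma le_barrier (r : ℝ) : (r - 18) / 3 ≤ barrier r := by
  unfold barrier; gcongr; exact le_max_left _ _

lemma isAdmissible_barrier : IsAdmissible barrier :=
  ⟨barrier_zero, fun a _ b _ _ => by simp⟩

lemma isAdmissible_id : IsAdmissible (fun r => r) := by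
  refine ⟨rfl, fun a _ b _ h => ?_⟩
  have : max (b - 18) 0 ≤ max (a - 18) 0 + (b - a) := by
    apply max_le
    · linarith [le_max_left (a - 18) 0]
    · linarith [le_max_right (a - 18) 0]
  simp only [barrier]
  linarith

namespace IsAdmissible

variable {G : ℝ → ℝ}

lemma monotoneOn (hG : IsAdmissible G) : MonotoneOn G (Ici 0) := by
  intro a ha b hb h
  have h1 := hG.sub_barrier ha hb h
  have h2 := barrier_mono h
  simp only at h1
  linarith

lemma barrier_le (hG : IsAdmissible G) {r : ℝ} (hr : 0 ≤ r) : barrier r ≤ G r := by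
  have := hG.sub_barrier self_mem_Ici hr hr
  simp only [hG.zero, barrier_zero] at this
  linarith

lemma aemeasurable (hG : IsAdmissible G) : AEMeasurable G (volume.restrict (Ioi 0)) :=
  aemeasurable_restrict_of_monotoneOn measurableSet_Ioi (hG.monotoneOn.mono Ioi_subset_Ici_self)

end IsAdmissible

lemma integrableOn_pow_mul_exp_neg_div_three (n : ℕ) :
    IntegrableOn (fun s : ℝ => s ^ n * Real.exp (-(s - 18) / 3)) (Ioi 0) := by
  have := (integrableOn_rpow_mul_exp_neg_mul_rpow (p := 1) (s := n) (b := 1 / 3)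
    (by have := n.cast_nonneg (α := ℝ); linarith) one_pos (by norm_num)).const_mul (Real.exp 6)
  refine IntegrableOn.congr_fun this (fun s _ => ?_) measurableSet_Ioi
  simp only [Real.rpow_natCast, Real.rpow_one]
  rw [mul_left_comm, ← Real.exp_add]
  congr 2; ring

lemma integrableOn_pow_mul_exp_neg_barrier (n : ℕ) :
    IntegrableOn (fun s : ℝ => s ^ n * Real.exp (-barrier s)) (Ioi 0) := by
  refine (integrableOn_pow_mul_exp_neg_div_three n).mono' ?_ ?_
  · have := barrier_mono.measurable
    exact (by fun_prop : Measurable _).aestronglyMeasurable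
  · refine (ae_restrict_iff' measurableSet_Ioi).2 (.of_forall fun s hs => ?_)
    have hs' : (0 : ℝ) < s := hs
    rw [Real.norm_of_nonneg (by positivity)]
    gcongr
    linarith [le_barrier s]

lemma radialWeight_nonneg (G : ℝ → ℝ) (s : ℝ) : 0 ≤ radialWeight G s := by
  unfold radialWeight; positivity

lemma shellKernel_sub_bound {r : ℝ} (hr : 0 ≤ r) :
    ∀ᵐ s ∂(volume.restrict (Ioi (0 : ℝ))), ‖shellKernel r s - s‖ ≤ r := by
  refine (ae_restrict_iff' measurableSet_Ioi).2 (.of_forall fun s hs => ?_)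
  rw [Real.norm_of_nonneg (by linarith [le_shellKernel hr hs])]
  linarith [shellKernel_le_add hr hs]

namespace IsAdmissible

variable {G : ℝ → ℝ}

lemma integrableOn_pow_mul_exp (hG : IsAdmissible G) (n : ℕ) :
    IntegrableOn (fun s : ℝ => s ^ n * Real.exp (-G s)) (Ioi 0) := by
  refine (integrableOn_pow_mul_exp_neg_barrier n).mono' ?_ ?_
  · have := hG.aemeasurable
    exact (by fun_prop : AEMeasurable _ _).aestronglyMeasurable
  · refine (ae_restrict_iff' measurableSet_Ioi).2 (.of_forall fun s hs => ?_)
    have hs' : (0 : ℝ) < s := hs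
    rw [Real.norm_of_nonneg (by positivity)]
    gcongr
    exact hG.barrier_le hs'.le

lemma integrableOn_radialWeight (hG : IsAdmissible G) : IntegrableOn (radialWeight G) (Ioi 0) :=
  hG.integrableOn_pow_mul_exp 2

lemma integrableOn_kernel_mul (hG : IsAdmissible G) {r : ℝ} (hr : 0 ≤ r) :
    IntegrableOn (fun s => (shellKernel r s - s) * radialWeight G s) (Ioi 0) :=
  hG.integrableOn_radialWeight.bdd_mul
    ((measurable_shellKernel r).sub measurable_id).aestronglyMeasurable (shellKernel_sub_bound hr)

lemma radialMass_pos (hG : IsAdmissible G) : 0 < radialMass G := by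
  refine (setIntegral_pos_iff_support_of_nonneg_ae
    (.of_forall fun s => radialWeight_nonneg G s) hG.integrableOn_radialWeight).2 ?_
  have : Function.support (radialWeight G) ∩ Ioi 0 = Ioi 0 := by
    refine inter_eq_right.2 fun s hs => ?_
    have hs' : (0 : ℝ) < s := hs
    exact (by unfold radialWeight; positivity : radialWeight G s ≠ 0)
  rw [this]; simp

lemma integrableOn_kernel_sub_mul (hG : IsAdmissible G) {r₁ r₂ : ℝ} (h₁ : 0 ≤ r₁)
    (h₂ : 0 ≤ r₂) : IntegrableOn
      (fun s => (shellKernel r₂ s - shellKernel r₁ s) * radialWeight G s) (Ioi 0) := by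
  refine ((hG.integrableOn_kernel_mul h₂).sub (hG.integrableOn_kernel_mul h₁)).congr_fun
    (fun s _ => ?_) measurableSet_Ioi
  simp only [Pi.sub_apply]; ring

lemma potentialMap_sub (hG : IsAdmissible G) {r₁ r₂ : ℝ} (h₁ : 0 ≤ r₁) (h₂ : 0 ≤ r₂) :
    potentialMap G r₂ - potentialMap G r₁ =
      (∫ s in Ioi 0, (shellKernel r₂ s - shellKernel r₁ s) * radialWeight G s) / radialMass G := by
  rw [potentialMap, potentialMap, ← sub_div,
    ← integral_sub (hG.integrableOn_kernel_mul h₂) (hG.integrableOn_kernel_mul h₁)]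
  congr 1
  refine integral_congr_ae (.of_forall fun s => ?_)
  simp only; ring

lemma potentialMap_zero : potentialMap G 0 = 0 := by
  rw [potentialMap, setIntegral_congr_fun (g := fun _ => 0) measurableSet_Ioi]
  · simp
  · intro s hs
    simp [shellKernel_zero_left hs]

lemma monotoneOn_id_sub_potentialMap (hG : IsAdmissible G) :
    MonotoneOn (fun r => r - potentialMap G r) (Ici 0) := by
  intro r₁ h₁ r₂ h₂ h
  have : potentialMap G r₂ - potentialMap G r₁ ≤ r₂ - r₁ := by
    rw [hG.potentialMap_sub h₁ h₂, div_le_iff₀ hG.radialMass_pos, radialMass,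
      ← integral_const_mul]
    refine setIntegral_mono_on (hG.integrableOn_kernel_sub_mul h₁ h₂)
      (hG.integrableOn_radialWeight.const_mul _) measurableSet_Ioi fun s hs => ?_
    refine mul_le_mul_of_nonneg_right ?_ (radialWeight_nonneg G s)
    linarith [shellKernel_le_add_sub h hs]
  simp only
  linarith

lemma monotoneOn_potentialMap_sub {G₁ G₂ : ℝ → ℝ} (hG₁ : IsAdmissible G₁)
    (hG₂ : IsAdmissible G₂) (h : MonotoneOn (fun r => G₂ r - G₁ r) (Ici 0)) :
    MonotoneOn (fun r => potentialMap G₂ r - potentialMap G₁ r) (Ici 0) := by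
  intro r₁ h₁ r₂ h₂ h12
  have : potentialMap G₁ r₂ - potentialMap G₁ r₁ ≤ potentialMap G₂ r₂ - potentialMap G₂ r₁ := by
    rw [hG₁.potentialMap_sub h₁ h₂, hG₂.potentialMap_sub h₁ h₂,
      div_le_div_iff₀ hG₁.radialMass_pos hG₂.radialMass_pos]
    refine integral_mul_integral_le_of_covary measurableSet_Ioi hG₁.integrableOn_radialWeight
      hG₂.integrableOn_radialWeight (hG₁.integrableOn_kernel_sub_mul h₁ h₂)
      (hG₂.integrableOn_kernel_sub_mul h₁ h₂) ?_
    have key : ∀ s ∈ Ioi (0 : ℝ), ∀ t ∈ Ioi (0 : ℝ), s ≤ t →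
        radialWeight G₂ t * radialWeight G₁ s ≤ radialWeight G₂ s * radialWeight G₁ t := by
      intro s hs t ht hst
      have e : ∀ a b : ℝ, radialWeight G₂ a * radialWeight G₁ b =
          a ^ 2 * b ^ 2 * Real.exp (-G₂ a - G₁ b) := by
        intro a b
        rw [sub_eq_add_neg, Real.exp_add, radialWeight, radialWeight]; ring
      rw [e, e, mul_comm (t ^ 2)]
      have := h (Ioi_subset_Ici_self hs) (Ioi_subset_Ici_self ht) hst
      simp only at this
      gcongr _ * Real.exp ?_
      linarith
    intro s hs t ht
    rcases le_total s t with hst | hst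
    · exact mul_nonneg (sub_nonneg.2 (shellKernel_sub_antitoneOn h₁ h12 hs ht hst))
        (sub_nonneg.2 (key s hs t ht hst))
    · exact mul_nonneg_of_nonpos_of_nonpos
        (sub_nonpos.2 (shellKernel_sub_antitoneOn h₁ h12 ht hs hst))
        (sub_nonpos.2 (key t ht s hs hst))
  simp only
  linarith

end IsAdmissible

lemma integral_Ioc_radialWeight_barrier :
    ∫ s in Ioc 0 18, radialWeight barrier s = 1944 := by
  rw [setIntegral_congr_fun (g := fun s => s ^ 2) measurableSet_Ioc,
    ← intervalIntegral.integral_of_le (by norm_num), integral_pow]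
  · norm_num
  · intro s hs
    simp [radialWeight, barrier, max_eq_right (sub_nonpos.2 hs.2)]

lemma integral_Ioi_radialWeight_barrier :
    ∫ s in Ioi 18, radialWeight barrier s = 1350 := by
  have hlim : Tendsto (fun s : ℝ => -(Real.exp (-(s - 18) / 3) * (3 * s ^ 2 + 18 * s + 54)))
      atTop (𝓝 0) := by
    have h : ∀ n : ℕ, Tendsto (fun s : ℝ => Real.exp 6 * (3 ^ n * ((s / 3) ^ n *
        Real.exp (-(s / 3))))) atTop (𝓝 (Real.exp 6 * (3 ^ n * 0))) := fun n =>
      (((Real.tendsto_pow_mul_exp_neg_atTop_nhds_zero n).comp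
        (tendsto_id.atTop_div_const (by norm_num))).const_mul _).const_mul _
    have := (((h 2).const_mul 3).add (((h 1).const_mul 18).add ((h 0).const_mul 54))).neg
    convert this using 2
    · rename_i s
      have : Real.exp (-(s - 18) / 3) = Real.exp 6 * Real.exp (-(s / 3)) := by
        rw [← Real.exp_add]; congr 1; ring
      rw [this]; ring
    · simp
  have := integral_Ioi_of_hasDerivAt_of_tendsto (a := (18 : ℝ)) (m := 0)
    (f := fun s : ℝ => -(Real.exp (-(s - 18) / 3) * (3 * s ^ 2 + 18 * s + 54)))
    (f' := fun s : ℝ => s ^ 2 * Real.exp (-(s - 18) / 3))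
    (Continuous.continuousWithinAt (by fun_prop)) (fun s _ => ?_)
    ((integrableOn_pow_mul_exp_neg_div_three 2).mono_set (Ioi_subset_Ioi (by norm_num))) hlim
  · rw [setIntegral_congr_fun (g := fun s => s ^ 2 * Real.exp (-(s - 18) / 3)) measurableSet_Ioi,
      this]
    · norm_num
    · intro s hs
      have hs' : (18 : ℝ) < s := hs
      simp only [radialWeight, barrier, max_eq_left (sub_nonneg.2 hs'.le), neg_div]
  · have h1 : HasDerivAt (fun s : ℝ => Real.exp (-(s - 18) / 3))
        (Real.exp (-(s - 18) / 3) * (-1 / 3)) s :=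
      ((((hasDerivAt_id s).sub_const 18).neg).div_const 3).exp
    have h2 : HasDerivAt (fun s : ℝ => 3 * s ^ 2 + 18 * s + 54) (6 * s + 18) s := by
      have := (((hasDerivAt_pow 2 s).const_mul 3).add ((hasDerivAt_id s).const_mul 18)).add_const 54
      exact this.congr_deriv (by norm_num; ring)
    exact (h1.mul h2).neg.congr_deriv (by ring)

lemma radialMass_barrier : radialMass barrier = 3294 := by
  have h := isAdmissible_barrier.integrableOn_radialWeight
  rw [radialMass, ← Ioc_union_Ioi_eq_Ioi (show (0 : ℝ) ≤ 18 by norm_num),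
    setIntegral_union (Ioc_disjoint_Ioi le_rfl) measurableSet_Ioi
      (h.mono_set Ioc_subset_Ioi_self) (h.mono_set (Ioi_subset_Ioi (by norm_num))),
    integral_Ioc_radialWeight_barrier, integral_Ioi_radialWeight_barrier]
  norm_num

lemma monotoneOn_potentialMap_barrier_sub :
    MonotoneOn (fun r => potentialMap barrier r - barrier r) (Ici 0) := by
  have hB := isAdmissible_barrier
  have small : ∀ r₁ r₂ : ℝ, 0 ≤ r₁ → r₁ ≤ r₂ → r₂ ≤ 18 →
      potentialMap barrier r₁ - barrier r₁ ≤ potentialMap barrier r₂ - barrier r₂ := by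
    intro r₁ r₂ h₁ h h₂
    have : 0 ≤ potentialMap barrier r₂ - potentialMap barrier r₁ := by
      rw [hB.potentialMap_sub h₁ (h₁.trans h)]
      refine div_nonneg (setIntegral_nonneg measurableSet_Ioi fun s hs => ?_) hB.radialMass_pos.le
      exact mul_nonneg (sub_nonneg.2 (shellKernel_mono h₁ h hs)) (radialWeight_nonneg _ _)
    have e : ∀ r ≤ (18 : ℝ), barrier r = 0 := fun r hr => by
      simp [barrier, max_eq_right (sub_nonpos.2 hr)]
    rw [e r₁ (h.trans h₂), e r₂ h₂]
    linarith
  have large : ∀ r₁ r₂ : ℝ, 18 ≤ r₁ → r₁ ≤ r₂ →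
      potentialMap barrier r₁ - barrier r₁ ≤ potentialMap barrier r₂ - barrier r₂ := by
    intro r₁ r₂ h₁ h
    have h₁' : (0 : ℝ) ≤ r₁ := by linarith
    have h₂' := h₁'.trans h
    have hint := hB.integrableOn_kernel_sub_mul h₁' h₂'
    have : (r₂ - r₁) / 3 ≤ potentialMap barrier r₂ - potentialMap barrier r₁ := by
      rw [hB.potentialMap_sub h₁' h₂', radialMass_barrier, le_div_iff₀ (by norm_num)]
      calc (r₂ - r₁) / 3 * 3294 ≤ 2 / 3 * (r₂ - r₁) * 1944 := by linarith
        _ = ∫ s in Ioc 0 18, 2 / 3 * (r₂ - r₁) * radialWeight barrier s := by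
          rw [integral_const_mul, integral_Ioc_radialWeight_barrier]
        _ ≤ ∫ s in Ioc 0 18, (shellKernel r₂ s - shellKernel r₁ s) * radialWeight barrier s := by
          refine setIntegral_mono_on
            ((hB.integrableOn_radialWeight.mono_set Ioc_subset_Ioi_self).const_mul _)
            (hint.mono_set Ioc_subset_Ioi_self) measurableSet_Ioc fun s hs => ?_
          exact mul_le_mul_of_nonneg_right
            (two_thirds_mul_le_shellKernel_sub h hs.1 (hs.2.trans h₁)) (radialWeight_nonneg _ _)
        _ ≤ _ := by
          refine setIntegral_mono_set hint ?_ Ioc_subset_Ioi_self.eventuallyLE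
          refine (ae_restrict_iff' measurableSet_Ioi).2 (.of_forall fun s hs => ?_)
          exact mul_nonneg (sub_nonneg.2 (shellKernel_mono h₁' h hs)) (radialWeight_nonneg _ _)
    have e : ∀ r ≥ (18 : ℝ), barrier r = (r - 18) / 3 := fun r hr => by
      simp [barrier, max_eq_left (sub_nonneg.2 hr)]
    rw [e r₁ h₁, e r₂ (h₁.trans h)]
    linarith
  intro r₁ h₁ r₂ _ h
  rcases le_total r₂ 18 with h2 | h2
  · exact small r₁ r₂ h₁ h h2
  rcases le_total 18 r₁ with h1 | h1
  · exact large r₁ r₂ h1 h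
  · exact (small r₁ 18 h₁ h1 le_rfl).trans (large 18 r₂ le_rfl h2)

lemma monotoneOn_sub_trans {f g h : ℝ → ℝ} {S : Set ℝ} (h₁ : MonotoneOn (fun r => g r - f r) S)
    (h₂ : MonotoneOn (fun r => h r - g r) S) : MonotoneOn (fun r => h r - f r) S := by
  intro a ha b hb hab
  have e₁ := h₁ ha hb hab
  have e₂ := h₂ ha hb hab
  simp only at *
  linarith

lemma isAdmissible_potentialMap {G : ℝ → ℝ} (hG : IsAdmissible G) :
    IsAdmissible (potentialMap G) :=
  ⟨IsAdmissible.potentialMap_zero, monotoneOn_sub_trans monotoneOn_potentialMap_barrier_sub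
    (IsAdmissible.monotoneOn_potentialMap_sub isAdmissible_barrier hG hG.sub_barrier)⟩

/-- Monotone iteration from the identity produces a fixed point of `potentialMap`. -/
lemma exists_fixedPoint_potentialMap : ∃ G : ℝ → ℝ, IsAdmissible G ∧
    MonotoneOn (fun r => r - G r) (Ici 0) ∧ ∀ r, 0 ≤ r → potentialMap G r = G r := by
  set F : ℕ → ℝ → ℝ := fun n => potentialMap^[n] (fun r => r) with hF
  have hsucc : ∀ n, F (n + 1) = potentialMap (F n) := fun n =>
    Function.iterate_succ_apply' _ _ _
  have hadm : ∀ n, IsAdmissible (F n) := by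
    intro n
    induction n with
    | zero => exact isAdmissible_id
    | succ n ih => rw [hsucc]; exact isAdmissible_potentialMap ih
  have hdec : ∀ n, MonotoneOn (fun r => F n r - F (n + 1) r) (Ici 0) := by
    intro n
    induction n with
    | zero => exact isAdmissible_id.monotoneOn_id_sub_potentialMap
    | succ n ih =>
      rw [hsucc n, hsucc (n + 1)]
      exact IsAdmissible.monotoneOn_potentialMap_sub (hadm _) (hadm _) ih
  have hanti : ∀ r, 0 ≤ r → Antitone fun n => F n r := by
    intro r hr
    refine antitone_nat_of_succ_le fun n => ?_
    have := hdec n self_mem_Ici hr hr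
    simp only [(hadm _).zero] at this
    linarith
  have hlim : ∀ r, 0 ≤ r → Tendsto (fun n => F n r) atTop (𝓝 (⨅ n, F n r)) := by
    intro r hr
    refine tendsto_atTop_ciInf (hanti r hr) ⟨barrier r, ?_⟩
    rintro _ ⟨n, rfl⟩
    exact (hadm n).barrier_le hr
  set G : ℝ → ℝ := fun r => ⨅ n, F n r
  have hG : IsAdmissible G := by
    refine ⟨?_, fun a ha b hb hab => ?_⟩
    · exact tendsto_nhds_unique (hlim 0 le_rfl) (by simp [(hadm _).zero])
    · exact le_of_tendsto_of_tendsto' ((hlim a ha).sub_const _) ((hlim b hb).sub_const _)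
        fun n => (hadm n).sub_barrier ha hb hab
  have hweight : ∀ s ∈ Ioi (0 : ℝ), Tendsto (fun n => radialWeight (F n) s) atTop
      (𝓝 (radialWeight G s)) := fun s hs =>
    ((Real.continuous_exp.tendsto _).comp (hlim s (le_of_lt hs)).neg).const_mul _
  have hweight_le : ∀ n, ∀ s ∈ Ioi (0 : ℝ), radialWeight (F n) s ≤ radialWeight barrier s := by
    intro n s hs
    unfold radialWeight
    gcongr
    exact (hadm n).barrier_le (le_of_lt hs)
  have hmass : Tendsto (fun n => radialMass (F n)) atTop (𝓝 (radialMass G)) := by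
    refine tendsto_integral_of_dominated_convergence (radialWeight barrier)
      (fun n => (hadm n).integrableOn_radialWeight.aestronglyMeasurable)
      isAdmissible_barrier.integrableOn_radialWeight (fun n => ?_) ?_
    · refine (ae_restrict_iff' measurableSet_Ioi).2 (.of_forall fun s hs => ?_)
      rw [Real.norm_of_nonneg (radialWeight_nonneg _ _)]
      exact hweight_le n s hs
    · exact (ae_restrict_iff' measurableSet_Ioi).2 (.of_forall hweight)
  have hmap : ∀ r, 0 ≤ r →
      Tendsto (fun n => potentialMap (F n) r) atTop (𝓝 (potentialMap G r)) := by
    intro r hr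
    refine Tendsto.div ?_ hmass hG.radialMass_pos.ne'
    refine tendsto_integral_of_dominated_convergence (fun s => r * radialWeight barrier s)
      (fun n => ((hadm n).integrableOn_kernel_mul hr).aestronglyMeasurable)
      (isAdmissible_barrier.integrableOn_radialWeight.const_mul r) (fun n => ?_) ?_
    · filter_upwards [shellKernel_sub_bound hr, ae_restrict_mem measurableSet_Ioi] with s hs hs'
      rw [norm_mul, Real.norm_of_nonneg (radialWeight_nonneg _ _)]
      exact mul_le_mul hs (hweight_le n s hs') (radialWeight_nonneg _ _) hr
    · exact (ae_restrict_iff' measurableSet_Ioi).2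
        (.of_forall fun s hs => (hweight s hs).const_mul _)
  have hfix : ∀ r, 0 ≤ r → potentialMap G r = G r := by
    intro r hr
    refine tendsto_nhds_unique (hmap r hr) ?_
    simpa only [Function.comp_def, hsucc] using (hlim r hr).comp (tendsto_add_atTop_nat 1)
  refine ⟨G, hG, fun a ha b hb hab => ?_, hfix⟩
  have := hG.monotoneOn_id_sub_potentialMap ha hb hab
  simpa only [hfix a ha, hfix b hb] using this

lemma image_sqrt_sq_add_sq_Ioi (z : ℝ) : (fun ρ => √(z ^ 2 + ρ ^ 2)) '' Ioi 0 = Ioi |z| := by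
  ext s
  constructor
  · rintro ⟨ρ, hρ, rfl⟩
    have hρ' : (0 : ℝ) < ρ := hρ
    exact Real.lt_sqrt_of_sq_lt (by rw [sq_abs]; nlinarith)
  · intro hs
    have hs' : |z| < s := hs
    have hs0 : 0 < s := (abs_nonneg z).trans_lt hs'
    have h : z ^ 2 < s ^ 2 := sq_lt_sq.2 (by rwa [abs_of_pos hs0])
    refine ⟨√(s ^ 2 - z ^ 2), Real.sqrt_pos.2 (sub_pos.2 h), ?_⟩
    simp only
    rw [Real.sq_sqrt (sub_nonneg.2 h.le), add_sub_cancel, Real.sqrt_sq hs0.le]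

/-- Integration over a plane at distance `|z|` from the origin of a function of the distance to
the origin. -/
lemma lintegral_plane_comp_norm (z : ℝ) {h : ℝ → ENNReal} (hh : Measurable h) :
    ∫⁻ q : ℝ × ℝ, h √(z ^ 2 + (q.1 ^ 2 + q.2 ^ 2)) =
      ∫⁻ s in Ioi |z|, ENNReal.ofReal (2 * Real.pi * s) * h s := by
  have h1 : ∫⁻ q : ℝ × ℝ, h √(z ^ 2 + (q.1 ^ 2 + q.2 ^ 2)) =
      ∫⁻ ρ in Ioi 0, ENNReal.ofReal (2 * Real.pi * ρ) * h √(z ^ 2 + ρ ^ 2) := by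
    rw [← lintegral_comp_polarCoord_symm, polarCoord_target, Measure.volume_eq_prod,
      ← Measure.prod_restrict]
    have e : ∀ p : ℝ × ℝ, ENNReal.ofReal p.1 • h √(z ^ 2 + ((polarCoord.symm p).1 ^ 2 +
        (polarCoord.symm p).2 ^ 2)) = ENNReal.ofReal p.1 * h √(z ^ 2 + p.1 ^ 2) := by
      intro p
      rw [polarCoord_symm_apply, smul_eq_mul]
      congr 4
      simp only
      linear_combination p.1 ^ 2 * Real.sin_sq_add_cos_sq p.2
    simp_rw [e]
    rw [lintegral_prod _ (by fun_prop)]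
    refine setLIntegral_congr_fun measurableSet_Ioi fun ρ _ => ?_
    simp only [lintegral_const, MeasurableSet.univ, Measure.restrict_apply, univ_inter,
      Real.volume_Ioo]
    rw [ENNReal.ofReal_mul (by positivity : 0 ≤ 2 * Real.pi),
      show Real.pi - -Real.pi = 2 * Real.pi by ring]
    ring
  have hd : ∀ ρ ∈ Ioi (0 : ℝ), HasDerivWithinAt (fun ρ => √(z ^ 2 + ρ ^ 2))
      (ρ / √(z ^ 2 + ρ ^ 2)) (Ioi 0) ρ := by
    intro ρ hρ
    have hρ' : (0 : ℝ) < ρ := hρ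
    have := (((hasDerivAt_pow 2 ρ).const_add (z ^ 2)).sqrt (by positivity)).hasDerivWithinAt
      (s := Ioi 0)
    refine this.congr_deriv ?_
    field_simp
    norm_num
  have hinj : InjOn (fun ρ => √(z ^ 2 + ρ ^ 2)) (Ioi 0) := by
    intro a ha b hb hab
    simp only at hab
    rw [Real.sqrt_inj (by positivity) (by positivity)] at hab
    exact (sq_eq_sq₀ (le_of_lt ha) (le_of_lt hb)).1 (by linarith)
  rw [h1, ← image_sqrt_sq_add_sq_Ioi,
    lintegral_image_eq_lintegral_abs_deriv_mul measurableSet_Ioi hd hinj]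
  refine setLIntegral_congr_fun measurableSet_Ioi fun ρ hρ => ?_
  have hρ' : (0 : ℝ) < ρ := hρ
  have hψ : 0 < √(z ^ 2 + ρ ^ 2) := by positivity
  rw [← mul_assoc, ← ENNReal.ofReal_mul (by positivity), abs_of_pos (by positivity)]
  congr 2
  field_simp

/-- Integration in `ℝ³` of a function of the first coordinate and of the norm. -/
lemma lintegral_coord_norm {g : ℝ → ℝ → ENNReal} (hg : Measurable (Function.uncurry g)) :
    ∫⁻ y : EuclideanSpace ℝ (Fin 3), g (y 0) ‖y‖ =
      ∫⁻ s in Ioi 0, ∫⁻ z in Ioo (-s) s, ENNReal.ofReal (2 * Real.pi * s) * g z s := by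
  have hT : MeasurePreserving (fun y : EuclideanSpace ℝ (Fin 3) => (y 0, (y 1, y 2)))
      volume volume :=
    (((MeasurePreserving.id volume).prod (volume_preserving_finTwoArrow ℝ)).comp
      (volume_preserving_piFinSuccAbove (fun _ : Fin 3 => ℝ) 0)).comp
      (PiLp.volume_preserving_ofLp (Fin 3))
  have hm : Measurable (fun p : ℝ × ℝ × ℝ =>
      g p.1 √(p.1 ^ 2 + (p.2.1 ^ 2 + p.2.2 ^ 2))) :=
    hg.comp (by fun_prop : Measurable fun p : ℝ × ℝ × ℝ =>
      (p.1, √(p.1 ^ 2 + (p.2.1 ^ 2 + p.2.2 ^ 2))))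
  have h1 : ∫⁻ y : EuclideanSpace ℝ (Fin 3), g (y 0) ‖y‖ =
      ∫⁻ p : ℝ × ℝ × ℝ, g p.1 √(p.1 ^ 2 + (p.2.1 ^ 2 + p.2.2 ^ 2)) := by
    rw [← hT.lintegral_comp hm]
    refine lintegral_congr fun y => ?_
    simp [EuclideanSpace.norm_eq, Fin.sum_univ_three, add_assoc]
  rw [h1, Measure.volume_eq_prod, lintegral_prod _ hm.aemeasurable]
  have h2 : ∀ z : ℝ, ∫⁻ q : ℝ × ℝ, g z √(z ^ 2 + (q.1 ^ 2 + q.2 ^ 2)) =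
      ∫⁻ s, {p : ℝ × ℝ | |p.1| < p.2}.indicator
        (fun p => ENNReal.ofReal (2 * Real.pi * p.2) * g p.1 p.2) (z, s) := by
    intro z
    rw [lintegral_plane_comp_norm z (h := g z) (hg.comp measurable_prodMk_left),
      ← lintegral_indicator measurableSet_Ioi]
    rfl
  simp_rw [h2]
  rw [lintegral_lintegral_swap, ← lintegral_indicator measurableSet_Ioi]
  · refine lintegral_congr fun s => ?_
    by_cases hs : s ∈ Ioi 0
    · rw [indicator_of_mem hs, ← lintegral_indicator measurableSet_Ioo]
      refine lintegral_congr fun z => ?_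
      by_cases hz : z ∈ Ioo (-s) s
      · rw [indicator_of_mem hz, indicator_of_mem]
        exact abs_lt.2 hz
      · rw [indicator_of_notMem hz, indicator_of_notMem]
        exact fun h => hz (abs_lt.1 h)
    · rw [indicator_of_notMem hs]
      refine (lintegral_congr fun z => indicator_of_notMem ?_ _).trans lintegral_zero
      exact fun h => hs ((abs_nonneg z).trans_lt h)
  · refine Measurable.aemeasurable (Measurable.indicator (by
      have := hg
      unfold Function.uncurry at this
      fun_prop) ?_)
    exact measurableSet_lt (by fun_prop) (by fun_prop)

lemma integral_sqrt_eq_shellKernel {r s : ℝ} (hr : 0 ≤ r) (hs : 0 < s) :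
    ∫ z in -s..s, √(r ^ 2 + s ^ 2 - 2 * r * z) = 2 * s * shellKernel r s := by
  rcases hr.eq_or_lt with rfl | hr
  · simp only [shellKernel_zero_left hs, mul_zero, zero_mul, sub_zero, ne_eq, OfNat.ofNat_ne_zero,
      not_false_eq_true, zero_pow, zero_add, Real.sqrt_sq hs.le,
      intervalIntegral.integral_const, smul_eq_mul]
    ring
  have hd : ∀ z ∈ uIcc (-s) s, HasDerivAt
      (fun z => -(1 / (3 * r)) * (r ^ 2 + s ^ 2 - 2 * r * z) ^ (3 / 2 : ℝ))
      √(r ^ 2 + s ^ 2 - 2 * r * z) z := by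
    intro z _
    have h1 : HasDerivAt (fun z : ℝ => r ^ 2 + s ^ 2 - 2 * r * z) (-(2 * r)) z := by
      simpa using ((hasDerivAt_id z).const_mul (2 * r)).const_sub (r ^ 2 + s ^ 2)
    have h2 := (h1.rpow_const (p := 3 / 2) (.inr (by norm_num))).const_mul (-(1 / (3 * r)))
    refine h2.congr_deriv ?_
    rw [Real.sqrt_eq_rpow, show (3 / 2 - 1 : ℝ) = 1 / 2 by norm_num]
    field_simp
  have hpow : ∀ x : ℝ, (x ^ 2) ^ (3 / 2 : ℝ) = |x| ^ 3 := by
    intro x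
    rw [← sq_abs, ← Real.rpow_natCast, ← Real.rpow_mul (abs_nonneg x), ← Real.rpow_natCast]
    norm_num
  rw [intervalIntegral.integral_eq_sub_of_hasDerivAt hd
    (Continuous.intervalIntegrable (by fun_prop) _ _),
    show r ^ 2 + s ^ 2 - 2 * r * s = (r - s) ^ 2 by ring,
    show r ^ 2 + s ^ 2 - 2 * r * -s = (r + s) ^ 2 by ring, hpow, hpow,
    abs_of_pos (by positivity : 0 < r + s)]
  rcases le_total s r with h | h
  · rw [abs_of_nonneg (sub_nonneg.2 h), shellKernel_of_le h]
    field_simp; ring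
  · rw [abs_of_nonpos (sub_nonpos.2 h), shellKernel_of_ge h]
    field_simp; ring

lemma norm_single_sub (r : ℝ) (y : EuclideanSpace ℝ (Fin 3)) :
    ‖EuclideanSpace.single 0 r - y‖ = √(r ^ 2 + ‖y‖ ^ 2 - 2 * r * y 0) := by
  rw [EuclideanSpace.norm_sq_eq, EuclideanSpace.norm_eq]
  congr 1
  simp [Fin.sum_univ_three]
  ring

lemma lintegral_norm_single_sub_mul {r : ℝ} (hr : 0 ≤ r) {f : ℝ → ℝ} (hf : Measurable f)
    (hf0 : ∀ s, 0 ≤ f s) :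
    ∫⁻ y : EuclideanSpace ℝ (Fin 3), ENNReal.ofReal (‖EuclideanSpace.single 0 r - y‖ * f ‖y‖) =
      ∫⁻ s in Ioi 0, ENNReal.ofReal (4 * Real.pi * (shellKernel r s * (s ^ 2 * f s))) := by
  simp_rw [norm_single_sub]
  rw [lintegral_coord_norm
    (g := fun z s => ENNReal.ofReal (√(r ^ 2 + s ^ 2 - 2 * r * z) * f s))
    (by unfold Function.uncurry; fun_prop)]
  refine setLIntegral_congr_fun measurableSet_Ioi fun s hs => ?_
  have hs' : (0 : ℝ) < s := hs
  have hc : 0 ≤ 2 * Real.pi * s := by positivity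
  have hint : IntegrableOn (fun z => √(r ^ 2 + s ^ 2 - 2 * r * z)) (Ioo (-s) s) :=
    (Continuous.integrableOn_Icc (by fun_prop)).mono_set Ioo_subset_Icc_self
  simp only [← ENNReal.ofReal_mul hc]
  rw [← ofReal_integral_eq_lintegral_ofReal ((hint.mul_const _).const_mul _)
    (.of_forall fun z => mul_nonneg hc (mul_nonneg (Real.sqrt_nonneg _) (hf0 s))),
    integral_const_mul, integral_mul_const, ← integral_Ioc_eq_integral_Ioo,
    ← intervalIntegral.integral_of_le (by linarith), integral_sqrt_eq_shellKernel hr hs]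
  congr 1
  ring

lemma lintegral_norm_sub_mul (x : EuclideanSpace ℝ (Fin 3)) {f : ℝ → ℝ} (hf : Measurable f)
    (hf0 : ∀ s, 0 ≤ f s) :
    ∫⁻ y : EuclideanSpace ℝ (Fin 3), ENNReal.ofReal (‖x - y‖ * f ‖y‖) =
      ∫⁻ s in Ioi 0, ENNReal.ofReal (4 * Real.pi * (shellKernel ‖x‖ s * (s ^ 2 * f s))) := by
  set e : EuclideanSpace ℝ (Fin 3) := EuclideanSpace.single 0 ‖x‖
  have he : ‖e‖ = ‖x‖ := by simp [e]
  set φ := (ℝ ∙ (e - x))ᗮ.reflection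
  have hφ : φ e = x := Submodule.reflection_sub he
  rw [← lintegral_norm_single_sub_mul (norm_nonneg x) hf hf0,
    ← (LinearIsometryEquiv.measurePreserving φ).lintegral_comp (by fun_prop)]
  refine lintegral_congr fun y => ?_
  rw [φ.norm_map, ← hφ, ← map_sub, φ.norm_map, hφ]

/-- The shell theorem for the kernel `‖x - y‖` in `ℝ³`. -/
lemma integrable_and_integral_norm_sub_mul (x : EuclideanSpace ℝ (Fin 3)) {f : ℝ → ℝ}
    (hf : Measurable f) (hf0 : ∀ s, 0 ≤ f s)
    (hint : IntegrableOn (fun s => shellKernel ‖x‖ s * (s ^ 2 * f s)) (Ioi 0)) :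
    Integrable (fun y : EuclideanSpace ℝ (Fin 3) => ‖x - y‖ * f ‖y‖) ∧
      ∫ y : EuclideanSpace ℝ (Fin 3), ‖x - y‖ * f ‖y‖ =
        4 * Real.pi * ∫ s in Ioi 0, shellKernel ‖x‖ s * (s ^ 2 * f s) := by
  have hm : AEStronglyMeasurable
      (fun y : EuclideanSpace ℝ (Fin 3) => ‖x - y‖ * f ‖y‖) volume :=
    (by fun_prop : Measurable _).aestronglyMeasurable
  have h0 : ∀ y : EuclideanSpace ℝ (Fin 3), 0 ≤ ‖x - y‖ * f ‖y‖ := fun y =>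
    mul_nonneg (norm_nonneg _) (hf0 _)
  have hK : 0 ≤ᵐ[volume.restrict (Ioi (0 : ℝ))]
      fun s => 4 * Real.pi * (shellKernel ‖x‖ s * (s ^ 2 * f s)) := by
    refine (ae_restrict_iff' measurableSet_Ioi).2 (.of_forall fun s hs => ?_)
    have h1 : 0 ≤ shellKernel ‖x‖ s := (le_of_lt hs).trans (le_shellKernel (norm_nonneg x) hs)
    have h2 := hf0 s
    simp only [Pi.zero_apply]
    positivity
  have hL := lintegral_norm_sub_mul x hf hf0
  rw [← ofReal_integral_eq_lintegral_ofReal (hint.const_mul _) hK] at hL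
  refine ⟨⟨hm, ?_⟩, ?_⟩
  · rw [hasFiniteIntegral_iff_ofReal (.of_forall h0), hL]
    exact ENNReal.ofReal_lt_top
  · rw [integral_eq_lintegral_of_nonneg_ae (.of_forall h0) hm, hL,
      ENNReal.toReal_ofReal (integral_nonneg_of_ae hK), integral_const_mul]

namespace IsAdmissible

variable {G : ℝ → ℝ}

lemma measurable_exp_neg_comp_max (hG : IsAdmissible G) :
    Measurable fun s => Real.exp (-G (max s 0)) := by
  have : Monotone fun s => G (max s 0) := fun a b h =>
    hG.monotoneOn (le_max_right a 0) (le_max_right b 0) (max_le_max_right 0 h)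
  exact Real.measurable_exp.comp this.measurable.neg

lemma integral_norm_sub_mul_exp (hG : IsAdmissible G)
    (hfix : ∀ r, 0 ≤ r → potentialMap G r = G r)
    (x : EuclideanSpace ℝ (Fin 3)) :
    Integrable (fun y : EuclideanSpace ℝ (Fin 3) => ‖x - y‖ * Real.exp (-G ‖y‖)) ∧
      ∫ y : EuclideanSpace ℝ (Fin 3), ‖x - y‖ * Real.exp (-G ‖y‖) =
        4 * Real.pi * (radialMass G * G ‖x‖ + ∫ s in Ioi 0, s * radialWeight G s) := by
  have hs : IntegrableOn (fun s => s * radialWeight G s) (Ioi 0) := by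
    refine IntegrableOn.congr_fun (hG.integrableOn_pow_mul_exp 3) (fun s _ => ?_)
      measurableSet_Ioi
    simp only [radialWeight]; ring
  have hk := hG.integrableOn_kernel_mul (norm_nonneg x)
  have heq : EqOn (fun s => (shellKernel ‖x‖ s - s) * radialWeight G s + s * radialWeight G s)
      (fun s => shellKernel ‖x‖ s * (s ^ 2 * Real.exp (-G (max s 0)))) (Ioi 0) := by
    intro s hs
    simp only [radialWeight, max_eq_left (mem_Ioi.1 hs).le]
    ring
  have hint := IntegrableOn.congr_fun (hk.add hs) heq measurableSet_Ioi
  have h := integrable_and_integral_norm_sub_mul x hG.measurable_exp_neg_comp_max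
    (fun s => (Real.exp_pos _).le) hint
  have hval : radialMass G * G ‖x‖ = ∫ s in Ioi 0, (shellKernel ‖x‖ s - s) * radialWeight G s := by
    rw [← hfix _ (norm_nonneg x), potentialMap, mul_div_cancel₀ _ hG.radialMass_pos.ne']
  rw [← setIntegral_congr_fun measurableSet_Ioi heq, integral_add hk hs, ← hval] at h
  simpa only [max_eq_left (norm_nonneg _)] using h

end IsAdmissible

/-- There exists a continuous radial function `u : ℝ³ → ℝ` with `|u(x)| ≤ C(1+|x|)` and
`u(x) ≤ δ(1−|x|)` for some constants `C, δ > 0`, solving the integral form of the 3D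
fourth-order Liouville equation `u(x) = −(1/(8π)) ∫_{ℝ³} |x−y| e^{u(y)} dy` (the integral
being convergent); consequently `u` has finite volume `∫_{ℝ³} e^u < ∞`. -/
theorem stmt10 :
    ∃ u : EuclideanSpace ℝ (Fin 3) → ℝ, Continuous u ∧
      (∀ x y : EuclideanSpace ℝ (Fin 3), ‖x‖ = ‖y‖ → u x = u y) ∧
      (∃ C : ℝ, 0 < C ∧ ∀ x : EuclideanSpace ℝ (Fin 3), |u x| ≤ C * (1 + ‖x‖)) ∧
      (∃ δ : ℝ, 0 < δ ∧ ∀ x : EuclideanSpace ℝ (Fin 3), u x ≤ δ * (1 - ‖x‖)) ∧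
      (∀ x : EuclideanSpace ℝ (Fin 3),
        Integrable (fun y : EuclideanSpace ℝ (Fin 3) => ‖x - y‖ * Real.exp (u y))) ∧
      (∀ x : EuclideanSpace ℝ (Fin 3),
        u x = -(1 / (8 * Real.pi)) *
          ∫ y : EuclideanSpace ℝ (Fin 3), ‖x - y‖ * Real.exp (u y)) ∧
      Integrable (fun x : EuclideanSpace ℝ (Fin 3) => Real.exp (u x)) := by
  obtain ⟨G, hG, hGid, hfix⟩ := exists_fixedPoint_potentialMap
  set Z := radialMass G with hZdef
  have hZ : 0 < Z := hG.radialMass_pos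
  set M := ∫ s in Ioi 0, s * radialWeight G s with hMdef
  have hM : 0 < M := by
    have h := (hG.integral_norm_sub_mul_exp hfix 0).2
    have hpos : 0 < ∫ y : EuclideanSpace ℝ (Fin 3), ‖0 - y‖ * Real.exp (-G ‖y‖) := by
      refine (integral_pos_iff_support_of_nonneg (fun y => by positivity)
        (hG.integral_norm_sub_mul_exp hfix 0).1).2 ?_
      have : Function.support (fun y : EuclideanSpace ℝ (Fin 3) =>
          ‖0 - y‖ * Real.exp (-G ‖y‖)) = {0}ᶜ := by
        ext y; simp [(Real.exp_pos _).ne']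
      rw [this]
      exact isOpen_compl_singleton.measure_pos _ ⟨EuclideanSpace.single 0 1, by simp⟩
    rw [h, norm_zero, hG.zero, mul_zero, zero_add] at hpos
    exact pos_of_mul_pos_right hpos (by positivity)
  set d := -M / Z with hd
  have hd0 : d < 0 := div_neg_of_neg_of_pos (neg_lt_zero.2 hM) hZ
  obtain ⟨l, hl, hl4⟩ : ∃ l : ℝ, 0 < l ∧ l ^ 4 = Real.exp d * Z / 2 := by
    refine ⟨(Real.exp d * Z / 2) ^ ((4 : ℕ) : ℝ)⁻¹, by positivity, ?_⟩
    exact Real.rpow_inv_natCast_pow (by positivity) (by norm_num)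
  have hGle : ∀ r, 0 ≤ r → G r ≤ r := by
    intro r hr
    have := hGid self_mem_Ici hr hr
    simp only [hG.zero] at this
    linarith
  have hGge : ∀ r, 0 ≤ r → (r - 18) / 3 ≤ G r := fun r hr =>
    (le_barrier r).trans (hG.barrier_le hr)
  have hG0 : ∀ r, 0 ≤ r → 0 ≤ G r := fun r hr => (barrier_nonneg r).trans (hG.barrier_le hr)
  have hcont : ContinuousOn G (Ici 0) := by
    refine (LipschitzOnWith.of_le_add_mul 1 fun a ha b hb => ?_).continuousOn
    rw [NNReal.coe_one, one_mul]
    rcases le_total a b with h | h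
    · linarith [hG.monotoneOn ha hb h, dist_nonneg (x := a) (y := b)]
    · have := hGid hb ha h
      simp only at this
      linarith [Real.dist_eq a b, le_abs_self (a - b)]
  have hexp : ∀ x y : EuclideanSpace ℝ (Fin 3), ‖x - y‖ * Real.exp (d - G (l * ‖y‖)) =
      Real.exp d * l⁻¹ * (‖l • x - l • y‖ * Real.exp (-G ‖l • y‖)) := by
    intro x y
    rw [← smul_sub, norm_smul, norm_smul, Real.norm_of_nonneg hl.le, sub_eq_add_neg d, Real.exp_add]
    field_simp
  have hint : ∀ x : EuclideanSpace ℝ (Fin 3), Integrable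
      (fun y : EuclideanSpace ℝ (Fin 3) => ‖x - y‖ * Real.exp (d - G (l * ‖y‖))) := by
    intro x
    simp_rw [hexp]
    exact ((integrable_comp_smul_iff volume
      (fun y => ‖l • x - y‖ * Real.exp (-G ‖y‖)) hl.ne').2
      (hG.integral_norm_sub_mul_exp hfix (l • x)).1).const_mul _
  have hu : Continuous fun x : EuclideanSpace ℝ (Fin 3) => d - G (l * ‖x‖) :=
    continuous_const.sub
      (hcont.comp_continuous (by fun_prop) fun x => by simp only [mem_Ici]; positivity)
  refine ⟨fun x => d - G (l * ‖x‖), hu, fun x y h => by simp only [h],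
    ⟨-d + l, by linarith, fun x => ?_⟩, ?_, hint, fun x => ?_, ?_⟩
  · have hx : 0 ≤ l * ‖x‖ := by positivity
    rw [abs_of_nonpos (by linarith [hG0 _ hx])]
    nlinarith [hGle _ hx, mul_nonneg (neg_nonneg.2 hd0.le) (norm_nonneg x)]
  · obtain ⟨θ, hθ0, hθ1, hθd⟩ : ∃ θ : ℝ, 0 < θ ∧ θ ≤ 1 ∧ d + 6 * θ ≤ 0 := by
      refine ⟨min 1 (-d / 6), lt_min one_pos (by linarith), min_le_left _ _, ?_⟩
      linarith [min_le_right 1 (-d / 6)]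
    refine ⟨θ * l / 3, by positivity, fun x => ?_⟩
    have hx : 0 ≤ l * ‖x‖ := by positivity
    have h1 : θ * ((l * ‖x‖ - 18) / 3) ≤ θ * G (l * ‖x‖) :=
      mul_le_mul_of_nonneg_left (hGge _ hx) hθ0.le
    have h2 : θ * G (l * ‖x‖) ≤ G (l * ‖x‖) := mul_le_of_le_one_left (hG0 _ hx) hθ1
    have h3 : 0 < θ * l := by positivity
    linarith
  · simp_rw [hexp]
    rw [integral_const_mul,
      Measure.integral_comp_smul volume (fun y => ‖l • x - y‖ * Real.exp (-G ‖y‖)) l,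
      (hG.integral_norm_sub_mul_exp hfix (l • x)).2, norm_smul, Real.norm_of_nonneg hl.le,
      finrank_euclideanSpace_fin, abs_of_pos (by positivity), ← hZdef, ← hMdef, smul_eq_mul]
    have h1 : Real.exp d = 2 * l ^ 4 / Z := by rw [hl4]; field_simp
    rw [h1, hd]
    have := Real.pi_pos.ne'
    field_simp
    ring
  · refine ((hint (EuclideanSpace.single 0 1)).add (hint 0)).mono'
      (by fun_prop : Continuous _).aestronglyMeasurable (.of_forall fun y => ?_)
    rw [Real.norm_of_nonneg (Real.exp_pos _).le]
    simp only [Pi.add_apply]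
    rw [← add_mul]
    refine le_mul_of_one_le_left (Real.exp_pos _).le ?_
    have := norm_sub_le (EuclideanSpace.single (0 : Fin 3) (1 : ℝ) - y) (0 - y)
    simpa using this
end

section
/- Let ε > 0 and let u : ℝ³ → ℝ be a continuous radial function (u(x) depends only on |x|) with |u(x)| ≤ C(1+|x|) for some C > 0, satisfying the regularized integral equation u(x) = −(1/(8π)) ∫_{ℝ³} |x−y| e^{−ε|y|²} e^{u(y)} dy for all x ∈ ℝ³. Then −6 < u(0) < 0. -/
open MeasureTheory

section InnerProductSpace

variable {V : Type*} [NormedAddCommGroup V] [InnerProductSpace ℝ V]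

theorem hasDerivAt_norm_smul_sub_one {x y : V} (h : x ≠ y) :
    HasDerivAt (fun t : ℝ => ‖t • x - y‖) (inner ℝ x (x - y) / ‖x - y‖) 1 := by
  have h1 : HasDerivAt (fun t : ℝ => t • x - y) x 1 := by
    simpa using ((hasDerivAt_id (1 : ℝ)).smul_const x).sub_const y
  have hne : ‖x - y‖ ≠ 0 := norm_ne_zero_iff.2 (sub_ne_zero.2 h)
  have h2 := h1.norm_sq.sqrt (by simpa using hne)
  simp only [Real.sqrt_sq (norm_nonneg _), one_smul] at h2
  refine h2.congr_deriv ?_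
  rw [real_inner_comm]
  field_simp

variable [FiniteDimensional ℝ V] [MeasurableSpace V] [BorelSpace V]

theorem integrable_exp_neg_mul_norm_sq {b : ℝ} (hb : 0 < b) :
    Integrable (fun x : V => Real.exp (-b * ‖x‖ ^ 2)) := by
  have h := (GaussianFourier.integrable_cexp_neg_mul_sq_norm_add (V := V) (b := (b : ℂ))
    (by simpa using hb) 0 0).norm
  refine h.congr (Filter.Eventually.of_forall fun x => ?_)
  simp only [zero_mul, add_zero, Complex.norm_exp]
  norm_cast

theorem integrable_one_add_norm_sq_mul_exp {b : ℝ} (hb : 0 < b) :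
    Integrable (fun x : V => (1 + ‖x‖ ^ 2) * Real.exp (-b * ‖x‖ ^ 2)) := by
  have h := (integrable_exp_neg_mul_norm_sq (V := V) (half_pos hb)).const_mul (1 + 2 / b)
  refine h.mono' (by fun_prop) (Filter.Eventually.of_forall fun x => ?_)
  rw [Real.norm_of_nonneg (by positivity)]
  have h1 : Real.exp (-b * ‖x‖ ^ 2)
      = Real.exp (-(b / 2) * ‖x‖ ^ 2) * Real.exp (-(b / 2 * ‖x‖ ^ 2)) := by
    rw [← Real.exp_add]; ring_nf
  have h2 : (1 + ‖x‖ ^ 2) ≤ (1 + 2 / b) * Real.exp (b / 2 * ‖x‖ ^ 2) := by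
    have h3 := Real.add_one_le_exp (b / 2 * ‖x‖ ^ 2)
    have h4 : 1 + ‖x‖ ^ 2 ≤ (1 + 2 / b) * (b / 2 * ‖x‖ ^ 2 + 1) := by
      have : (1 + 2 / b) * (b / 2 * ‖x‖ ^ 2 + 1)
        = 1 + ‖x‖ ^ 2 + (2 / b + b / 2 * ‖x‖ ^ 2) := by field_simp; ring
      rw [this]
      have : 0 ≤ 2 / b + b / 2 * ‖x‖ ^ 2 := by positivity
      linarith
    exact h4.trans (by gcongr)
  have h5 : (1 + ‖x‖ ^ 2) * Real.exp (-(b / 2 * ‖x‖ ^ 2)) ≤ 1 + 2 / b := by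
    rw [Real.exp_neg, ← div_eq_mul_inv, div_le_iff₀ (Real.exp_pos _)]
    exact h2
  rw [h1]
  calc _ = (1 + ‖x‖ ^ 2) * Real.exp (-(b / 2 * ‖x‖ ^ 2)) * Real.exp (-(b / 2) * ‖x‖ ^ 2) := by
        ring
    _ ≤ _ := by gcongr

/-- A continuous function of at most quadratic growth is integrable against a weight with finite
second moment. -/
theorem integrable_mul_of_quadratic_growth {f K : V → ℝ} (hf : Continuous f) (hK : Continuous K)
    (hK0 : ∀ x, 0 ≤ K x) (hKi : Integrable (fun x => (1 + ‖x‖ ^ 2) * K x)) {A : ℝ}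
    (hfA : ∀ x, |f x| ≤ A * (1 + ‖x‖ ^ 2)) : Integrable (fun x => f x * K x) := by
  refine (hKi.const_mul A).mono' (by fun_prop) (Filter.Eventually.of_forall fun x => ?_)
  rw [norm_mul, Real.norm_eq_abs, Real.norm_of_nonneg (hK0 x), ← mul_assoc]
  exact mul_le_mul_of_nonneg_right (hfA x) (hK0 x)

theorem integrable_of_integrable_one_add_norm_sq_mul {K : V → ℝ} (hK : Continuous K)
    (hK0 : ∀ x, 0 ≤ K x) (hKi : Integrable (fun x => (1 + ‖x‖ ^ 2) * K x)) : Integrable K := by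
  simpa using integrable_mul_of_quadratic_growth (f := fun _ => 1) (A := 1) continuous_const
    hK hK0 hKi (fun x => by rw [abs_one]; nlinarith [sq_nonneg ‖x‖])

theorem integrable_norm_sq_mul_of_integrable_one_add_norm_sq_mul {K : V → ℝ} (hK : Continuous K)
    (hK0 : ∀ x, 0 ≤ K x) (hKi : Integrable (fun x => (1 + ‖x‖ ^ 2) * K x)) :
    Integrable (fun x => ‖x‖ ^ 2 * K x) :=
  integrable_mul_of_quadratic_growth (A := 1) (by fun_prop) hK hK0 hKi
    (fun x => by rw [abs_of_nonneg (by positivity)]; linarith)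

/-- The potential `∫ ‖x - y‖ K(y) dy` of an even weight is minimal at the origin. -/
theorem integral_norm_zero_sub_le_of_even {K : V → ℝ} (hKneg : ∀ x, K (-x) = K x)
    (hK0 : ∀ x, 0 ≤ K x) (hint : ∀ x : V, Integrable (fun y => ‖x - y‖ * K y)) (x : V) :
    ∫ y, ‖0 - y‖ * K y ≤ ∫ y, ‖x - y‖ * K y := by
  have h1 : ∫ y, ‖-x - y‖ * K y = ∫ y, ‖x - y‖ * K y := by
    rw [← integral_neg_eq_self]
    refine integral_congr_ae (Filter.Eventually.of_forall fun y => ?_)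
    simp only [hKneg]
    rw [neg_sub_neg, norm_sub_rev]
  have h2 : ∫ y, 2 * (‖0 - y‖ * K y) ≤ ∫ y, (‖x - y‖ * K y + ‖-x - y‖ * K y) := by
    refine integral_mono ((hint 0).const_mul 2) ((hint x).add (hint (-x))) fun y => ?_
    have h3 := norm_add_le (x - y) (-x - y)
    have h4 : x - y + (-x - y) = (2 : ℝ) • (0 - y) := by rw [two_smul]; abel
    rw [h4, norm_smul, Real.norm_two] at h3
    simp only
    rw [← mul_assoc, ← add_mul]
    exact mul_le_mul_of_nonneg_right h3 (hK0 y)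
  rw [integral_const_mul, integral_add (hint x) (hint (-x)), h1] at h2
  linarith

theorem integrable_norm_smul_sub_mul {K : V → ℝ} (hK : Continuous K)
    (hKi : Integrable K) (hK1 : Integrable (fun x => ‖x‖ * K x)) (t : ℝ) :
    Integrable (fun p : V × V => ‖t • p.1 - p.2‖ * (K p.1 * K p.2)) (volume.prod volume) := by
  have hb := ((hK1.norm.mul_prod hKi.norm).const_mul |t|).add (hKi.norm.mul_prod hK1.norm)
  refine hb.mono' (by fun_prop) (Filter.Eventually.of_forall fun p => ?_)
  simp only [norm_mul, norm_norm, Pi.add_apply]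
  have h := norm_sub_le (t • p.1) p.2
  rw [norm_smul, Real.norm_eq_abs] at h
  calc _ ≤ (|t| * ‖p.1‖ + ‖p.2‖) * (‖K p.1‖ * ‖K p.2‖) := by gcongr
    _ = _ := by ring

variable [Nontrivial V]

theorem ae_prod_fst_ne_snd :
    ∀ᵐ p : V × V ∂(volume.prod volume), p.1 ≠ p.2 := by
  refine (Measure.ae_prod_iff_ae_ae (p := fun p : V × V => p.1 ≠ p.2)
    (measurableSet_eq_fun measurable_fst measurable_snd).compl).2
    (Filter.Eventually.of_forall fun x => ?_)
  filter_upwards [Measure.ae_ne volume x] with y hy using hy.symm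

/-- The derivative at `t = 1` of `∬ ‖t x - y‖ K(x) K(y)` is half of its value there. -/
theorem hasDerivAt_integral_norm_smul_sub {K : V → ℝ} (hK : Continuous K)
    (hKi : Integrable K) (hK1 : Integrable (fun x => ‖x‖ * K x)) :
    HasDerivAt
      (fun t : ℝ => ∫ p : V × V, ‖t • p.1 - p.2‖ * (K p.1 * K p.2) ∂(volume.prod volume))
      ((∫ p : V × V, ‖p.1 - p.2‖ * (K p.1 * K p.2) ∂(volume.prod volume)) / 2) 1 := by
  set F' : V × V → ℝ := fun p => inner ℝ p.1 (p.1 - p.2) / ‖p.1 - p.2‖ * (K p.1 * K p.2)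
  have key := hasDerivAt_integral_of_dominated_loc_of_lip (𝕜 := ℝ) (x₀ := (1 : ℝ))
    (μ := (volume.prod volume : Measure (V × V)))
    (F := fun t p => ‖t • p.1 - p.2‖ * (K p.1 * K p.2)) (F' := F')
    (bound := fun p => ‖p.1‖ * K p.1 * K p.2) (s := Set.univ) Filter.univ_mem
    (Filter.Eventually.of_forall fun t => (by fun_prop))
    (integrable_norm_smul_sub_mul hK hKi hK1 1)
    (by
      refine AEMeasurable.aestronglyMeasurable (Measurable.aemeasurable ?_)
      exact ((by fun_prop : Continuous fun p : V × V => inner ℝ p.1 (p.1 - p.2)).measurable.div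
        (by fun_prop : Continuous fun p : V × V => ‖p.1 - p.2‖).measurable).mul
        (by fun_prop : Continuous fun p : V × V => K p.1 * K p.2).measurable)
    (Filter.Eventually.of_forall fun p => by
      refine LipschitzOnWith.of_dist_le_mul fun s _ t _ => ?_
      rw [Real.dist_eq, Real.dist_eq, Real.coe_nnabs, ← sub_mul, abs_mul, abs_mul, abs_mul,
        abs_mul, abs_norm]
      have h := abs_norm_sub_norm_le (s • p.1 - p.2) (t • p.1 - p.2)
      rw [sub_sub_sub_cancel_right, ← sub_smul, norm_smul, Real.norm_eq_abs] at h
      calc _ ≤ |s - t| * ‖p.1‖ * (|K p.1| * |K p.2|) := by gcongr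
        _ = _ := by ring)
    (hK1.mul_prod hKi)
    (by
      filter_upwards [ae_prod_fst_ne_snd (V := V)] with p hp
      exact (hasDerivAt_norm_smul_sub_one hp).mul_const _)
  refine key.2.congr_deriv ?_
  have hsum : (∫ p, F' p ∂(volume.prod volume)) + ∫ p, F' p.swap ∂(volume.prod volume)
      = ∫ p : V × V, ‖p.1 - p.2‖ * (K p.1 * K p.2) ∂(volume.prod volume) := by
    rw [← integral_add key.1 (by exact key.1.swap)]
    refine integral_congr_ae ?_
    filter_upwards [ae_prod_fst_ne_snd (V := V)] with p hp
    have hne : ‖p.1 - p.2‖ ≠ 0 := norm_ne_zero_iff.2 (sub_ne_zero.2 hp)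
    have h1 : inner ℝ p.1 (p.1 - p.2) + inner ℝ p.2 (p.2 - p.1) = ‖p.1 - p.2‖ ^ 2 := by
      rw [← real_inner_self_eq_norm_sq, inner_sub_left, ← neg_sub p.1 p.2, inner_neg_right]
      ring
    simp only [F', Prod.fst_swap, Prod.snd_swap, norm_sub_rev p.2 p.1]
    rw [mul_comm (K p.2), ← add_mul, ← add_div, h1]
    field_simp
  rw [integral_prod_swap] at hsum
  linarith

end InnerProductSpace

/-- Pohozaev-type identity for the Gaussian-regularized integral equation. -/
theorem pohozaev_identity {ε : ℝ} {u : EuclideanSpace ℝ (Fin 3) → ℝ} (hu : Continuous u) {C : ℝ}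
    (hgrowth : ∀ x : EuclideanSpace ℝ (Fin 3), |u x| ≤ C * (1 + ‖x‖))
    (hKi : Integrable (fun x : EuclideanSpace ℝ (Fin 3) => (1 + ‖x‖ ^ 2) * Real.exp (-ε * ‖x‖ ^ 2 + u x)))
    (heq : ∀ x : EuclideanSpace ℝ (Fin 3), u x = -(1 / (8 * Real.pi)) *
        ∫ y : EuclideanSpace ℝ (Fin 3), ‖x - y‖ * Real.exp (-ε * ‖y‖ ^ 2 + u y)) :
    (∫ x : EuclideanSpace ℝ (Fin 3), u x * Real.exp (-ε * ‖x‖ ^ 2 + u x))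
      + 6 * (∫ x : EuclideanSpace ℝ (Fin 3), Real.exp (-ε * ‖x‖ ^ 2 + u x))
      = 4 * ε * ∫ x : EuclideanSpace ℝ (Fin 3), ‖x‖ ^ 2 * Real.exp (-ε * ‖x‖ ^ 2 + u x) := by
  set K : EuclideanSpace ℝ (Fin 3) → ℝ := fun x => Real.exp (-ε * ‖x‖ ^ 2 + u x) with hKdef
  have hK : Continuous K := by fun_prop
  have hK0 : ∀ x, 0 ≤ K x := fun x => (Real.exp_pos _).le
  have hC : 0 ≤ C := by
    have := (abs_nonneg _).trans (hgrowth 0)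
    simpa using this
  have hI0 := integrable_of_integrable_one_add_norm_sq_mul hK hK0 hKi
  have hI1 : Integrable (fun x => ‖x‖ * K x) :=
    integrable_mul_of_quadratic_growth (A := 1) continuous_norm hK hK0 hKi
      (fun x => by rw [abs_norm]; nlinarith [sq_nonneg (‖x‖ - 1), sq_nonneg ‖x‖])
  have hI2 :=
    integrable_norm_sq_mul_of_integrable_one_add_norm_sq_mul hK hK0 hKi
  have hIu : ∀ t : ℝ, Integrable (fun x => u (t • x) * K x) := fun t => by
    refine integrable_mul_of_quadratic_growth (A := C * (1 + |t|)) (by fun_prop) hK hK0 hKi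
      (fun x => (hgrowth _).trans ?_)
    rw [norm_smul, Real.norm_eq_abs, mul_assoc]
    refine mul_le_mul_of_nonneg_left ?_ hC
    nlinarith [mul_nonneg (abs_nonneg t) (sq_nonneg (‖x‖ - 1)), abs_nonneg t, sq_nonneg ‖x‖,
      mul_nonneg (abs_nonneg t) (sq_nonneg ‖x‖)]
  set M := ∫ x, K x
  set S := ∫ x, ‖x‖ ^ 2 * K x
  set G : ℝ → ℝ := fun t => ∫ x, u (t • x) * K x with hG
  have hG_eq : ∀ t, G t = -(1 / (8 * Real.pi)) *
      ∫ p : EuclideanSpace ℝ (Fin 3) × EuclideanSpace ℝ (Fin 3),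
        ‖t • p.1 - p.2‖ * (K p.1 * K p.2) ∂(volume.prod volume) := fun t => by
    rw [integral_prod _ (integrable_norm_smul_sub_mul hK hI0 hI1 t), ← integral_const_mul]
    refine integral_congr_ae (Filter.Eventually.of_forall fun x => ?_)
    simp only
    rw [heq (t • x), mul_assoc, ← integral_mul_const]
    congr 2
    ext y
    simp only [hKdef]
    ring
  have hG' : HasDerivAt G (G 1 / 2) 1 := by
    rw [hG_eq 1, funext hG_eq]
    refine ((hasDerivAt_integral_norm_smul_sub hK hI0 hI1).const_mul _).congr_deriv ?_
    simp only [one_smul]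
    ring
  have hmin : IsLocalMin (fun t : ℝ => (t ^ 3)⁻¹ * M - G t + ε * t ^ 2 * S) 1 := by
    filter_upwards [lt_mem_nhds (zero_lt_one : (0 : ℝ) < 1)] with t ht
    have hscale : ∫ x, K (t • x) = (t ^ 3)⁻¹ * M := by
      rw [Measure.integral_comp_smul, finrank_euclideanSpace_fin, abs_of_pos (by positivity),
        smul_eq_mul]
    have hle : ∫ x, (K x + (u (t • x) * K x - u ((1 : ℝ) • x) * K x)
        - ε * (t ^ 2 - 1) * (‖x‖ ^ 2 * K x)) ≤ ∫ x, K (t • x) := by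
      refine integral_mono ((hI0.add ((hIu t).sub (hIu 1))).sub (hI2.const_mul _))
        (hI0.comp_smul ht.ne') fun x => ?_
      simp only [one_smul]
      have h1 : K (t • x) = K x * Real.exp (u (t • x) - u x - ε * (t ^ 2 - 1) * ‖x‖ ^ 2) := by
        simp only [hKdef]
        rw [← Real.exp_add, norm_smul, mul_pow, Real.norm_eq_abs, sq_abs]
        ring_nf
      rw [h1]
      have h2 := mul_le_mul_of_nonneg_left
        (Real.add_one_le_exp (u (t • x) - u x - ε * (t ^ 2 - 1) * ‖x‖ ^ 2)) (hK0 x)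
      linarith
    rw [integral_sub (by exact hI0.add ((hIu t).sub (hIu 1))) (hI2.const_mul _),
      integral_add hI0 (by exact (hIu t).sub (hIu 1)), integral_sub (hIu t) (hIu 1),
      integral_const_mul, hscale] at hle
    change M + (G t - G 1) - ε * (t ^ 2 - 1) * S ≤ (t ^ 3)⁻¹ * M at hle
    norm_num
    linarith
  have hderiv : HasDerivAt (fun t : ℝ => (t ^ 3)⁻¹ * M - G t + ε * t ^ 2 * S)
      (-3 * M - G 1 / 2 + ε * 2 * S) 1 := by
    have h3 : HasDerivAt (fun t : ℝ => (t ^ 3)⁻¹) (-3) 1 := by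
      refine ((hasDerivAt_pow 3 (1 : ℝ)).fun_inv (by norm_num)).congr_deriv ?_
      norm_num
    have h2 : HasDerivAt (fun t : ℝ => t ^ 2) 2 1 := by
      simpa using hasDerivAt_pow 2 (1 : ℝ)
    exact ((h3.mul_const M).sub hG').add ((h2.const_mul ε).mul_const S)
  have h0 := hmin.hasDerivAt_eq_zero hderiv
  have hG1 : G 1 = ∫ x, u x * K x := by simp [hG]
  rw [← hG1]
  linarith

/-- If `u : ℝ³ → ℝ` is a continuous radial function growing at most linearly and satisfying the
regularized integral equation `u(x) = −(1/(8π)) ∫_{ℝ³} |x−y| e^{−ε|y|²} e^{u(y)} dy` for all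
`x`, then `−6 < u(0) < 0`. -/
theorem stmt14 (ε : ℝ) (hε : 0 < ε) (u : EuclideanSpace ℝ (Fin 3) → ℝ)
    (hu : Continuous u)
    (hrad : ∀ x y : EuclideanSpace ℝ (Fin 3), ‖x‖ = ‖y‖ → u x = u y)
    (C : ℝ) (hC : 0 < C)
    (hgrowth : ∀ x : EuclideanSpace ℝ (Fin 3), |u x| ≤ C * (1 + ‖x‖))
    (heq : ∀ x : EuclideanSpace ℝ (Fin 3),
      u x = -(1 / (8 * Real.pi)) *
        ∫ y : EuclideanSpace ℝ (Fin 3), ‖x - y‖ * Real.exp (-ε * ‖y‖ ^ 2) * Real.exp (u y)) :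
    -6 < u 0 ∧ u 0 < 0 := by
  simp only [mul_assoc, ← Real.exp_add] at heq
  have hpi : 0 < 1 / (8 * Real.pi) := by positivity
  have hnonpos : ∀ x, u x ≤ 0 := fun x => by
    rw [heq x, neg_mul, neg_nonpos]
    exact mul_nonneg hpi.le (integral_nonneg fun y => by positivity)
  set K : EuclideanSpace ℝ (Fin 3) → ℝ := fun x => Real.exp (-ε * ‖x‖ ^ 2 + u x) with hKdef
  have hK : Continuous K := by fun_prop
  have hK0 : ∀ x, 0 < K x := fun x => Real.exp_pos _
  have hKi : Integrable (fun x : EuclideanSpace ℝ (Fin 3) => (1 + ‖x‖ ^ 2) * K x) := by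
    refine (integrable_one_add_norm_sq_mul_exp (V := EuclideanSpace ℝ (Fin 3)) hε).mono' (by fun_prop)
      (Filter.Eventually.of_forall fun x => ?_)
    rw [Real.norm_of_nonneg (mul_nonneg (by positivity) (hK0 x).le)]
    refine mul_le_mul_of_nonneg_left (Real.exp_le_exp.2 ?_) (by positivity)
    linarith [hnonpos x]
  have hint : ∀ x : EuclideanSpace ℝ (Fin 3), Integrable (fun y => ‖x - y‖ * K y) := fun x => by
    refine integrable_mul_of_quadratic_growth (A := ‖x‖ + 1) (by fun_prop) hK
      (fun x => (hK0 x).le) hKi (fun y => ?_)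
    rw [abs_norm]
    refine (norm_sub_le x y).trans ?_
    nlinarith [sq_nonneg (‖y‖ - 1), sq_nonneg ‖y‖, mul_nonneg (norm_nonneg x) (sq_nonneg ‖y‖)]
  obtain ⟨e, he⟩ := exists_ne (0 : EuclideanSpace ℝ (Fin 3))
  have he' : 0 < ‖e‖ := norm_pos_iff.2 he
  have hneg : u 0 < 0 := by
    rw [heq 0, neg_mul, neg_lt_zero]
    refine mul_pos hpi (integral_pos_of_integrable_nonneg_nonzero (x := e)
      (by fun_prop) (hint 0) (fun y => mul_nonneg (norm_nonneg _) (hK0 y).le) ?_)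
    rw [zero_sub, norm_neg]
    exact (mul_pos he' (hK0 e)).ne'
  have hKneg : ∀ x, K (-x) = K x := fun x => by
    simp only [hKdef, norm_neg, hrad (-x) x (norm_neg x)]
  have hmax : ∀ x, u x ≤ u 0 := fun x => by
    rw [heq x, heq 0, neg_mul, neg_mul, neg_le_neg_iff]
    exact mul_le_mul_of_nonneg_left
      (integral_norm_zero_sub_le_of_even hKneg (fun y => (hK0 y).le) hint x) hpi.le
  refine ⟨?_, hneg⟩
  have hP : (∫ x, u x * K x) + 6 * (∫ x, K x) = 4 * ε * ∫ x, ‖x‖ ^ 2 * K x :=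
    pohozaev_identity hu hgrowth hKi heq
  have hI0 := integrable_of_integrable_one_add_norm_sq_mul hK (fun x => (hK0 x).le) hKi
  have hIu : Integrable (fun x => u x * K x) := by
    refine integrable_mul_of_quadratic_growth (A := C * 2) hu hK (fun x => (hK0 x).le) hKi
      (fun x => (hgrowth x).trans ?_)
    rw [mul_assoc]
    exact mul_le_mul_of_nonneg_left (by nlinarith [sq_nonneg (‖x‖ - 1), sq_nonneg ‖x‖]) hC.le
  have hI2 :=
    integrable_norm_sq_mul_of_integrable_one_add_norm_sq_mul hK (fun x => (hK0 x).le) hKi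
  have hM : 0 < ∫ x, K x :=
    integral_pos_of_integrable_nonneg_nonzero (x := 0) hK hI0 (fun x => (hK0 x).le) (hK0 0).ne'
  have hS : 0 < ∫ x, ‖x‖ ^ 2 * K x :=
    integral_pos_of_integrable_nonneg_nonzero (x := e) (by fun_prop) hI2
      (fun x => mul_nonneg (by positivity) (hK0 x).le) (mul_pos (pow_pos he' 2) (hK0 e)).ne'
  have hle : ∫ x, u x * K x ≤ u 0 * ∫ x, K x := by
    rw [← integral_const_mul]
    exact integral_mono hIu (hI0.const_mul _)
      fun x => mul_le_mul_of_nonneg_right (hmax x) (hK0 x).le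
  have hpos : 0 < (u 0 + 6) * ∫ x, K x := by
    have : 0 < 4 * ε * ∫ x, ‖x‖ ^ 2 * K x := mul_pos (by positivity) hS
    linarith
  linarith [(pos_iff_pos_of_mul_pos hpos).2 hM]
end
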